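/- arXiv:2207.06230 — 7 statements merged into one kernel-verified Lean document; each statement's English description precedes it below -/
import Mathlib

section
/- Let q₀,…,q₆ ∈ ℝ² be the vertices of a regular heptagon (qⱼ = c + r·(cos(2πj/7 + θ), sin(2πj/7 + θ)), r > 0) such that no two of them have the same first coordinate, and let F := {f(q₀),…,f(q₆)}. Then for every vertical line L = {(a, y) : y ∈ ℝ}, the set L ∩ ⋃F has exactly 4 or exactly 7 points. In particular, no vertical line meets ⋃F in exactly 5 = 7−2 or exactly 6 = 7−1 points. -/
/-- The non-vertical line associated to a point `(A, B)`:
`f(A,B) = {(x,y) : y + A·x + B = 0}`. -/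
def fline (p : ℝ × ℝ) : Set (ℝ × ℝ) :=
  {q : ℝ × ℝ | q.2 + p.1 * q.1 + p.2 = 0}

/-- A line in `ℝ²`: a set of the form `{a + t • v : t ∈ ℝ}` with `v ≠ 0`. -/
def IsLine (L : Set (ℝ × ℝ)) : Prop :=
  ∃ a v : ℝ × ℝ, v ≠ 0 ∧ L = {p : ℝ × ℝ | ∃ t : ℝ, p = a + t • v}

/-- A vertical line: a set of the form `{(a, y) : y ∈ ℝ}`. -/
def IsVerticalLine (L : Set (ℝ × ℝ)) : Prop :=
  ∃ a : ℝ, L = {p : ℝ × ℝ | p.1 = a}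

/-- Two lines are parallel if they have a common direction vector
(equivalently, their direction vectors are proportional). -/
def Par (L M : Set (ℝ × ℝ)) : Prop :=
  ∃ (a b v : ℝ × ℝ), v ≠ 0 ∧
    L = {p : ℝ × ℝ | ∃ t : ℝ, p = a + t • v} ∧
    M = {p : ℝ × ℝ | ∃ t : ℝ, p = b + t • v}

/-- `ISet Q` is the set of all cardinalities `|G|`, where `G` ranges over finite
families of pairwise parallel lines covering `Q`, each member of which meets `Q`. -/
def ISet (Q : Set (ℝ × ℝ)) : Set ℕ :=
  {n : ℕ | ∃ G : Finset (Set (ℝ × ℝ)), G.card = n ∧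
    (∀ L ∈ G, IsLine L) ∧
    (∀ L ∈ G, ∀ M ∈ G, Par L M) ∧
    Q ⊆ ⋃₀ (↑G : Set (Set (ℝ × ℝ))) ∧
    (∀ L ∈ G, (L ∩ Q).Nonempty)}

lemma aux_comb : ∀ s : Fin 7, (∀ i j : Fin 7, min i (s - i) = min j (s - j) ↔ (i = j ∨ i + j = s)) ∧
    (Finset.univ.image (fun i : Fin 7 => min i (s - i))).card = 4 := by
  decide

lemma aux_card (h : Fin 7 → ℝ × ℝ) (s : Fin 7) (H : ∀ i j, h i = h j ↔ (i = j ∨ i + j = s)) :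
    (Set.range h).ncard = 4 := by
  obtain ⟨h1, h2⟩ := aux_comb s
  set k : Fin 7 → Fin 7 := fun i => min i (s - i) with hk
  have hkk : ∀ i j, k i = k j ↔ h i = h j := fun i j => by rw [H]; exact h1 i j
  have e : Function.FactorsThrough h k := fun i j hij => (hkk i j).1 hij
  have hr : Set.range h = (fun x => Function.extend k h (fun _ => 0) x) '' (Set.range k) := by
    rw [← Set.range_comp]
    congr 1
    funext i
    exact (e.extend_apply (fun _ => 0) i).symm
  rw [hr, Set.ncard_image_of_injOn]
  · rw [← h2, ← Set.ncard_coe_finset]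
    simp
  · rintro _ ⟨i, rfl⟩ _ ⟨j, rfl⟩ hij
    simp only [e.extend_apply] at hij
    exact (hkk i j).2 hij

lemma aux_cos (ψ : ℝ) (i j : Fin 7) :
    Real.cos (2 * Real.pi * ((i : ℕ) : ℝ) / 7 + ψ) = Real.cos (2 * Real.pi * ((j : ℕ) : ℝ) / 7 + ψ)
    ↔ (i = j ∨ ∃ k : ℤ, 7 * ψ = Real.pi * ((7 * k - (i : ℕ) - (j : ℕ) : ℤ) : ℝ)) := by
  have hp := Real.pi_pos
  rw [Real.cos_eq_cos_iff]
  constructor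
  · rintro ⟨k, h | h⟩
    · left
      have h' : Real.pi * (((j : ℕ) : ℝ) - ((i : ℕ) : ℝ) - 7 * k) = 0 := by linarith
      have h2 := (mul_eq_zero.1 h').resolve_left hp.ne'
      have h3 : ((j : ℕ) : ℤ) - ((i : ℕ) : ℤ) - 7 * k = 0 := by exact_mod_cast h2
      omega
    · right
      refine ⟨k, ?_⟩
      push_cast
      linarith
  · rintro (h | ⟨k, h⟩)
    · exact ⟨0, Or.inl (by subst h; simp)⟩
    · refine ⟨k, Or.inr ?_⟩
      push_cast at h
      linarith

theorem statement_3 (q : Fin 7 → ℝ × ℝ) (c : ℝ × ℝ) (r θ : ℝ) (hr : 0 < r)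
    (hq : ∀ j : Fin 7, q j = c + r •
      (Real.cos (2 * Real.pi * ((j : ℕ) : ℝ) / 7 + θ),
       Real.sin (2 * Real.pi * ((j : ℕ) : ℝ) / 7 + θ)))
    (hx : ∀ i j : Fin 7, i ≠ j → (q i).1 ≠ (q j).1) (a : ℝ) :
    ({p : ℝ × ℝ | p.1 = a} ∩ ⋃ i : Fin 7, fline (q i)).ncard = 4 ∨
    ({p : ℝ × ℝ | p.1 = a} ∩ ⋃ i : Fin 7, fline (q i)).ncard = 7 := by
  have hβ := Real.cos_arctan_pos a
  set β := Real.arctan a with hβd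
  have ha : a = Real.sin β / Real.cos β := by rw [← Real.tan_eq_sin_div_cos, hβd, Real.tan_arctan]
  set h : Fin 7 → ℝ × ℝ := fun j => (a, -((q j).1 * a + (q j).2)) with hh
  have hS : ({p : ℝ × ℝ | p.1 = a} ∩ ⋃ i : Fin 7, fline (q i)) = Set.range h := by
    ext ⟨x, y⟩
    simp only [Set.mem_inter_iff, Set.mem_setOf_eq, Set.mem_iUnion, fline, Set.mem_range, hh,
      Prod.mk.injEq]
    constructor
    · rintro ⟨rfl, i, hi⟩
      exact ⟨i, rfl, by linarith⟩
    · rintro ⟨i, rfl, hi⟩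
      exact ⟨rfl, i, by linarith⟩
  rw [hS]
  set ψ := θ + β - Real.pi / 2 with hψ
  have key : ∀ j : Fin 7, (q j).1 * a + (q j).2 =
      c.1 * a + c.2 + r / Real.cos β * Real.cos (2 * Real.pi * ((j : ℕ) : ℝ) / 7 + ψ) := by
    intro j
    have e : 2 * Real.pi * ((j : ℕ) : ℝ) / 7 + ψ =
      (2 * Real.pi * ((j : ℕ) : ℝ) / 7 + θ) + β - Real.pi / 2 := by rw [hψ]; ring
    rw [e, Real.cos_sub_pi_div_two, Real.sin_add, hq j]
    simp only [Prod.fst_add, Prod.snd_add, Prod.smul_fst, Prod.smul_snd, smul_eq_mul]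
    generalize 2 * Real.pi * ((j : ℕ) : ℝ) / 7 + θ = t
    have ha' : a * Real.cos β = Real.sin β := by rw [ha]; field_simp
    rw [← ha']
    field_simp
    ring
  have hR : r / Real.cos β ≠ 0 := (div_pos hr hβ).ne'
  have hiff : ∀ i j, h i = h j ↔
      (i = j ∨ ∃ k : ℤ, 7 * ψ = Real.pi * ((7 * k - (i : ℕ) - (j : ℕ) : ℤ) : ℝ)) := by
    intro i j
    rw [← aux_cos]
    simp only [hh, Prod.mk.injEq, true_and, neg_inj, key, add_right_inj]
    exact mul_right_inj' hR
  by_cases hinj : Function.Injective h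
  · right
    rw [← Set.image_univ, Set.ncard_image_of_injective _ hinj]
    simp
  · left
    simp only [Function.Injective, not_forall] at hinj
    obtain ⟨i0, j0, h0, hne⟩ := hinj
    obtain ⟨k0, hk0⟩ := ((hiff i0 j0).1 h0).resolve_left hne
    apply aux_card h (i0 + j0)
    intro i j
    rw [hiff, hk0]
    apply or_congr_right
    rw [Fin.ext_iff, Fin.val_add, Fin.val_add]
    constructor
    · rintro ⟨k, hk⟩
      have h3 := Int.cast_injective (mul_left_cancel₀ Real.pi_ne_zero hk)
      omega
    · intro hm
      refine ⟨k0 + (((i : ℕ) + (j : ℕ) : ℤ) - (i0 : ℕ) - (j0 : ℕ)) / 7, ?_⟩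
      congr 2
      omega
end

section
/- Let q₀,…,q₆ ∈ ℝ² be the vertices of a regular heptagon (qⱼ = c + r·(cos(2πj/7 + θ), sin(2πj/7 + θ)), r > 0). If K is a line passing through two distinct vertices qᵢ, qⱼ, then there are exactly 4 lines parallel to K (including K itself) that contain at least one of the vertices q₀,…,q₆. -/
lemma h7_line {a v x u : ℝ × ℝ} {s : ℝ} (hs : s ≠ 0) (hu : v = s • u)
    (hx : ∃ t : ℝ, x = a + t • v) :
    {p : ℝ × ℝ | ∃ t : ℝ, p = a + t • v} = {p : ℝ × ℝ | ∃ t : ℝ, p = x + t • u} := by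
  obtain ⟨t0, rfl⟩ := hx
  subst hu
  ext p
  constructor
  · rintro ⟨t, rfl⟩
    refine ⟨(t - t0) * s, ?_⟩
    module
  · rintro ⟨t, rfl⟩
    refine ⟨t0 + t / s, ?_⟩
    have : t • u = (t / s * s) • u := by rw [div_mul_cancel₀ _ hs]
    rw [this]
    module

lemma h7_sin (k : ℤ) : Real.sin (Real.pi * (k : ℝ) / 7) = 0 ↔ (7 : ℤ) ∣ k := by
  rw [Real.sin_eq_zero_iff]
  constructor
  · rintro ⟨n, hn⟩
    refine ⟨n, ?_⟩
    have h : (k : ℝ) = 7 * n := by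
      have hp := Real.pi_pos.ne'
      field_simp at hn
      linarith
    exact_mod_cast h
  · rintro ⟨n, rfl⟩
    refine ⟨n, ?_⟩
    push_cast
    ring

lemma h7_diff (q : Fin 7 → ℝ × ℝ) (c : ℝ × ℝ) (r θ : ℝ)
    (hq : ∀ j : Fin 7, q j = c + r •
      (Real.cos (2 * Real.pi * ((j : ℕ) : ℝ) / 7 + θ),
       Real.sin (2 * Real.pi * ((j : ℕ) : ℝ) / 7 + θ))) (m n : Fin 7) :
    q m - q n = (2 * r * Real.sin (Real.pi * (((m : ℕ) - (n : ℕ) : ℤ) : ℝ) / 7)) •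
      (-Real.sin (Real.pi * (((m : ℕ) + (n : ℕ) : ℤ) : ℝ) / 7 + θ),
        Real.cos (Real.pi * (((m : ℕ) + (n : ℕ) : ℤ) : ℝ) / 7 + θ)) := by
  rw [hq m, hq n]
  set A := Real.pi * (((m : ℕ) + (n : ℕ) : ℤ) : ℝ) / 7 + θ with hA
  set B := Real.pi * (((m : ℕ) - (n : ℕ) : ℤ) : ℝ) / 7 with hB
  have h1 : 2 * Real.pi * ((m : ℕ) : ℝ) / 7 + θ = A + B := by
    rw [hA, hB]; push_cast; ring
  have h2 : 2 * Real.pi * ((n : ℕ) : ℝ) / 7 + θ = A - B := by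
    rw [hA, hB]; push_cast; ring
  rw [h1, h2, Real.cos_add A B, Real.cos_sub A B, Real.sin_add A B, Real.sin_sub A B]
  ext <;> simp <;> ring

lemma h7_dvd (m n : Fin 7) : (7 : ℤ) ∣ ((m : ℕ) - (n : ℕ) : ℤ) ↔ m = n := by
  rw [Fin.ext_iff]; omega

lemma h7_dvd2 (m n i j : Fin 7) :
    (7 : ℤ) ∣ (((m : ℕ) + (n : ℕ) : ℤ) - ((i : ℕ) + (j : ℕ) : ℤ)) ↔ m + n = i + j := by
  rw [Fin.ext_iff, Fin.val_add, Fin.val_add]; omega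

lemma h7_count {α : Type*} (f : Fin 7 → α) (s : Fin 7)
    (hf : ∀ m n, f m = f n ↔ (m = n ∨ m + n = s)) : (Set.range f).ncard = 4 := by
  have hT : Set.range f = f '' ((Finset.univ.filter (fun m : Fin 7 => m ≤ s - m) : Finset (Fin 7)) : Set (Fin 7)) := by
    ext y
    constructor
    · rintro ⟨m, rfl⟩
      by_cases h : m ≤ s - m
      · exact ⟨m, by simpa using h, rfl⟩
      · refine ⟨s - m, ?_, (hf _ _).2 (Or.inr (by simp))⟩
        simp only [Finset.coe_filter, Finset.mem_univ, true_and, Set.mem_ofPred_eq]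
        rw [sub_sub_cancel]
        exact (not_le.1 h).le
    · rintro ⟨m, -, rfl⟩
      exact ⟨m, rfl⟩
  rw [hT, Set.ncard_image_of_injOn, Set.ncard_coe_finset]
  · clear hT hf; revert s; decide
  · intro m hm n hn h
    simp only [Finset.coe_filter, Finset.mem_univ, true_and, Set.mem_ofPred_eq] at hm hn
    rcases (hf _ _).1 h with h | h
    · exact h
    · subst h
      rw [add_sub_cancel_left] at hm
      rw [add_sub_cancel_right] at hn
      exact le_antisymm hm hn

theorem statement_4 (q : Fin 7 → ℝ × ℝ) (c : ℝ × ℝ) (r θ : ℝ) (hr : 0 < r)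
    (hq : ∀ j : Fin 7, q j = c + r •
      (Real.cos (2 * Real.pi * ((j : ℕ) : ℝ) / 7 + θ),
       Real.sin (2 * Real.pi * ((j : ℕ) : ℝ) / 7 + θ)))
    (K : Set (ℝ × ℝ)) (hK : IsLine K) (i j : Fin 7) (hij : i ≠ j)
    (hiK : q i ∈ K) (hjK : q j ∈ K) :
    {L : Set (ℝ × ℝ) | IsLine L ∧ Par L K ∧ ∃ m : Fin 7, q m ∈ L}.ncard = 4 := by
  set φ : ℝ := Real.pi * (((i : ℕ) + (j : ℕ) : ℤ) : ℝ) / 7 + θ with hφ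
  set u : ℝ × ℝ := (-Real.sin φ, Real.cos φ) with hu
  have hu0 : u ≠ 0 := by
    intro h
    have h1 : -Real.sin φ = 0 := congrArg Prod.fst h
    have h2 : Real.cos φ = 0 := congrArg Prod.snd h
    nlinarith [Real.sin_sq_add_cos_sq φ]
  set f : Fin 7 → Set (ℝ × ℝ) := fun m => {p | ∃ t : ℝ, p = q m + t • u} with hf
  have hd := h7_diff q c r θ hq
  -- any direction vector of `K` is proportional to `u`
  have hdir : ∀ b v : ℝ × ℝ, K = {p : ℝ × ℝ | ∃ t : ℝ, p = b + t • v} →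
      ∃ s : ℝ, s ≠ 0 ∧ v = s • u := by
    intro b v hKv
    rw [hKv] at hiK hjK
    obtain ⟨t1, h1⟩ := hiK
    obtain ⟨t2, h2⟩ := hjK
    have h3 := hd i j
    rw [← hφ, ← hu] at h3
    set S := 2 * r * Real.sin (Real.pi * (((i : ℕ) - (j : ℕ) : ℤ) : ℝ) / 7) with hS
    have hS0 : S ≠ 0 := by
      refine mul_ne_zero (by positivity) ?_
      rw [Ne, h7_sin, h7_dvd]
      exact hij
    have h4 : (t1 - t2) • v = S • u := by
      rw [← h3, h1, h2]; module
    have h5 : t1 - t2 ≠ 0 := by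
      intro h
      rw [h, zero_smul] at h4
      exact (smul_ne_zero hS0 hu0) h4.symm
    refine ⟨(t1 - t2)⁻¹ * S, mul_ne_zero (inv_ne_zero h5) hS0, ?_⟩
    rw [mul_smul, ← h4, smul_smul, inv_mul_cancel₀ h5, one_smul]
  have hset : {L : Set (ℝ × ℝ) | IsLine L ∧ Par L K ∧ ∃ m : Fin 7, q m ∈ L} = Set.range f := by
    ext L
    constructor
    · rintro ⟨-, ⟨a, b, v, hv, hL, hKv⟩, m, hm⟩
      obtain ⟨s, hs, hvu⟩ := hdir b v hKv
      rw [hL] at hm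
      exact ⟨m, by rw [hL]; exact (h7_line hs hvu hm).symm⟩
    · rintro ⟨m, rfl⟩
      refine ⟨⟨q m, u, hu0, rfl⟩, ⟨q m, q i, u, hu0, rfl, ?_⟩, m, 0, by simp⟩
      obtain ⟨b, v, hv, hKv⟩ := hK
      obtain ⟨s, hs, hvu⟩ := hdir b v hKv
      rw [hKv] at hiK
      rw [hKv]
      exact h7_line hs hvu hiK
  rw [hset]
  refine h7_count f (i + j) ?_
  intro m n
  have hmem : f m = f n ↔ ∃ t : ℝ, q m - q n = t • u := by
    constructor
    · intro h
      have : q m ∈ f m := ⟨0, by simp⟩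
      rw [h] at this
      obtain ⟨t, ht⟩ := this
      exact ⟨t, by rw [ht]; module⟩
    · rintro ⟨t, ht⟩
      exact (h7_line (s := 1) one_ne_zero (by simp)
        ⟨t, by rw [← ht]; abel⟩ : f n = f m).symm
  rw [hmem, hd m n, ← h7_dvd m n, ← h7_dvd2 m n i j, ← h7_sin, ← h7_sin]
  set S := Real.sin (Real.pi * (((m : ℕ) - (n : ℕ) : ℤ) : ℝ) / 7)
  set ψ := Real.pi * (((m : ℕ) + (n : ℕ) : ℤ) : ℝ) / 7 + θ with hψ
  have hδ : Real.pi * (((((m : ℕ) + (n : ℕ) : ℤ) - ((i : ℕ) + (j : ℕ) : ℤ) : ℤ)) : ℝ) / 7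
      = ψ - φ := by
    rw [hψ, hφ]; push_cast; ring
  rw [hδ]
  have hcs := Real.sin_sq_add_cos_sq φ
  constructor
  · rintro ⟨t, ht⟩
    have e1 : 2 * r * S * -Real.sin ψ = t * -Real.sin φ := congrArg Prod.fst ht
    have e2 : 2 * r * S * Real.cos ψ = t * Real.cos φ := congrArg Prod.snd ht
    have e3 : (2 * r) * (S * Real.sin (ψ - φ)) = 0 := by
      rw [Real.sin_sub]
      linear_combination (-Real.cos φ) * e1 - Real.sin φ * e2
    rcases mul_eq_zero.1 e3 with h | h
    · linarith
    · exact mul_eq_zero.1 h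
  · rintro (h | h)
    · exact ⟨0, by rw [h]; simp⟩
    · refine ⟨2 * r * S * Real.cos (ψ - φ), ?_⟩
      have e : ψ = φ + (ψ - φ) := by ring
      have es : Real.sin ψ = Real.sin φ * Real.cos (ψ - φ) := by
        conv_lhs => rw [e, Real.sin_add, h]
        ring
      have ec : Real.cos ψ = Real.cos φ * Real.cos (ψ - φ) := by
        conv_lhs => rw [e, Real.cos_add, h]
        ring
      rw [es, ec, hu]
      ext <;> simp <;> ring
end

section
/- Let Q ⊆ ℝ² be a finite set such that no two distinct points of Q have the same first coordinate, and let k be a natural number. Then k ∈ I(Q) if and only if there exists a vertical line L = {(a, y) : y ∈ ℝ} such that L ∩ ⋃_{q ∈ Q} f(q) has exactly k points. -/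
def lev (v : ℝ × ℝ) (c : ℝ) : Set (ℝ × ℝ) := {p | v.1 * p.2 - v.2 * p.1 = c}

lemma line_eq_lev (a v : ℝ × ℝ) (hv : v ≠ 0) :
    {p : ℝ × ℝ | ∃ t : ℝ, p = a + t • v} = lev v (v.1 * a.2 - v.2 * a.1) := by
  obtain ⟨a1, a2⟩ := a
  obtain ⟨v1, v2⟩ := v
  ext ⟨x, y⟩
  simp only [lev, Set.mem_ofPred_eq, Prod.smul_mk, Prod.mk_add_mk, Prod.mk.injEq, smul_eq_mul]
  constructor
  · rintro ⟨t, rfl, rfl⟩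
    ring
  · intro h
    by_cases h1 : v1 = 0
    · subst h1
      have h2 : v2 ≠ 0 := by
        rintro rfl
        exact hv rfl
      refine ⟨(y - a2) / v2, ?_, ?_⟩
      · apply mul_left_cancel₀ h2
        linarith
      · field_simp
        ring
    · refine ⟨(x - a1) / v1, ?_, ?_⟩
      · field_simp
        ring
      · field_simp
        linarith

lemma lev_eq_line (v : ℝ × ℝ) (hv : v ≠ 0) (c : ℝ) :
    ∃ a : ℝ × ℝ, lev v c = {p : ℝ × ℝ | ∃ t : ℝ, p = a + t • v} := by
  have hn : v.1 * v.1 + v.2 * v.2 ≠ 0 := by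
    intro h
    apply hv
    have h1 : v.1 = 0 := by nlinarith [mul_self_nonneg v.1, mul_self_nonneg v.2]
    have h2 : v.2 = 0 := by nlinarith [mul_self_nonneg v.1, mul_self_nonneg v.2]
    exact Prod.ext h1 h2
  refine ⟨(-v.2 * c / (v.1 * v.1 + v.2 * v.2), v.1 * c / (v.1 * v.1 + v.2 * v.2)), ?_⟩
  rw [line_eq_lev _ _ hv]
  congr 1
  simp only
  have e : v.1 * (v.1 * c / (v.1 * v.1 + v.2 * v.2)) - v.2 * (-v.2 * c / (v.1 * v.1 + v.2 * v.2))
      = c * ((v.1 * v.1 + v.2 * v.2) / (v.1 * v.1 + v.2 * v.2)) := by ring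
  rw [e, div_self hn, mul_one]

lemma par_lev (v : ℝ × ℝ) (hv : v ≠ 0) (c : ℝ) (M : Set (ℝ × ℝ)) (h : Par (lev v c) M) :
    ∃ d, M = lev v d := by
  obtain ⟨a, b, w, hw, hL, hM⟩ := h
  have ha : a ∈ lev v c := by rw [hL]; exact ⟨0, by simp⟩
  have haw : a + w ∈ lev v c := by rw [hL]; exact ⟨1, by simp⟩
  refine ⟨v.1 * b.2 - v.2 * b.1, ?_⟩
  rw [hM, ← line_eq_lev b v hv]
  have h0 : w ∈ lev v (v.1 * (0 : ℝ × ℝ).2 - v.2 * (0 : ℝ × ℝ).1) := by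
    simp only [lev, Set.mem_ofPred_eq, Prod.fst_add, Prod.snd_add, Prod.fst_zero,
      Prod.snd_zero] at *
    linarith
  rw [← line_eq_lev 0 v hv] at h0
  obtain ⟨s, hs⟩ := h0
  rw [zero_add] at hs
  subst hs
  have hs : s ≠ 0 := by
    rintro rfl
    simp at hw
  ext p
  constructor
  · rintro ⟨t, rfl⟩
    exact ⟨t * s, by rw [smul_smul]⟩
  · rintro ⟨t, rfl⟩
    exact ⟨t / s, by rw [smul_smul, div_mul_cancel₀ _ hs]⟩

lemma iset_iff (Q : Set (ℝ × ℝ)) (hQ : Q.Finite) (k : ℕ) :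
    k ∈ ISet Q ↔ ∃ v : ℝ × ℝ, v ≠ 0 ∧ ((fun p : ℝ × ℝ => v.1 * p.2 - v.2 * p.1) '' Q).ncard = k := by
  classical
  constructor
  · rintro ⟨G, rfl, hl, hp, hc, hm⟩
    rcases G.eq_empty_or_nonempty with rfl | ⟨L, hL⟩
    · refine ⟨(1, 0), by simp, ?_⟩
      have : Q = ∅ := by simpa using hc
      simp [this]
    · obtain ⟨a, v, hv, rfl⟩ := hl L hL
      rw [line_eq_lev a v hv] at hL
      have key : ∀ M ∈ G, ∃ d, M = lev v d := fun M hM => par_lev v hv _ M (hp _ hL M hM)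
      refine ⟨v, hv, ?_⟩
      have hG : (G : Set (Set (ℝ × ℝ))) =
          (fun p : ℝ × ℝ => lev v (v.1 * p.2 - v.2 * p.1)) '' Q := by
        ext M
        constructor
        · intro hM
          obtain ⟨q, hq, hqQ⟩ := hm M hM
          obtain ⟨d, rfl⟩ := key M hM
          refine ⟨q, hqQ, ?_⟩
          have : v.1 * q.2 - v.2 * q.1 = d := hq
          simp only [this]
        · rintro ⟨q, hq, rfl⟩
          obtain ⟨M, hM, hqM⟩ := hc hq
          obtain ⟨d, rfl⟩ := key M hM
          have : v.1 * q.2 - v.2 * q.1 = d := hqM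
          simp only [this]
          exact hM
      rw [← Set.ncard_coe_finset, hG, ← Function.comp_def (lev v), Set.image_comp]
      symm
      apply Set.ncard_image_of_injOn
      rintro _ ⟨q, hq, rfl⟩ d - h
      have : q ∈ lev v d := by rw [← h]; rfl
      exact this
  · rintro ⟨v, hv, rfl⟩
    have hfin : ((fun p : ℝ × ℝ => lev v (v.1 * p.2 - v.2 * p.1)) '' Q).Finite := hQ.image _
    refine ⟨hfin.toFinset, ?_, ?_, ?_, ?_, ?_⟩
    · rw [← Set.ncard_eq_toFinset_card _ hfin, ← Function.comp_def (lev v), Set.image_comp]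
      apply Set.ncard_image_of_injOn
      rintro _ ⟨q, hq, rfl⟩ d - h
      have : q ∈ lev v d := by rw [← h]; rfl
      exact this
    · intro L hL
      rw [Set.Finite.mem_toFinset] at hL
      obtain ⟨q, hq, rfl⟩ := hL
      obtain ⟨a, ha⟩ := lev_eq_line v hv (v.1 * q.2 - v.2 * q.1)
      exact ⟨a, v, hv, ha⟩
    · intro L hL M hM
      rw [Set.Finite.mem_toFinset] at hL hM
      obtain ⟨q, hq, rfl⟩ := hL
      obtain ⟨r, hr, rfl⟩ := hM
      obtain ⟨a, ha⟩ := lev_eq_line v hv (v.1 * q.2 - v.2 * q.1)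
      obtain ⟨b, hb⟩ := lev_eq_line v hv (v.1 * r.2 - v.2 * r.1)
      exact ⟨a, b, v, hv, ha, hb⟩
    · intro q hq
      rw [Set.Finite.coe_toFinset]
      exact ⟨_, ⟨q, hq, rfl⟩, rfl⟩
    · intro L hL
      rw [Set.Finite.mem_toFinset] at hL
      obtain ⟨q, hq, rfl⟩ := hL
      exact ⟨q, rfl, hq⟩

lemma vert_ncard (Q : Set (ℝ × ℝ)) (a : ℝ) :
    ({p : ℝ × ℝ | p.1 = a} ∩ ⋃ q ∈ Q, fline q).ncard =
      ((fun p : ℝ × ℝ => p.2 + a * p.1) '' Q).ncard := by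
  have : ({p : ℝ × ℝ | p.1 = a} ∩ ⋃ q ∈ Q, fline q) =
      (fun c : ℝ => (a, -c)) '' ((fun p : ℝ × ℝ => p.2 + a * p.1) '' Q) := by
    ext ⟨x, y⟩
    simp only [Set.mem_inter_iff, Set.mem_ofPred_eq, Set.mem_iUnion, fline, Set.mem_image,
      exists_prop, exists_exists_and_eq_and, Prod.mk.injEq]
    constructor
    · rintro ⟨rfl, q, hq, h⟩
      exact ⟨q, hq, rfl, by linarith⟩
    · rintro ⟨q, hq, rfl, rfl⟩
      exact ⟨rfl, q, hq, by ring⟩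
  rw [this]
  apply Set.ncard_image_of_injective
  intro c d h
  simpa using h

lemma exists_generic (Q : Set (ℝ × ℝ)) (hQ : Q.Finite)
    (hx : ∀ p ∈ Q, ∀ p' ∈ Q, p ≠ p' → p.1 ≠ p'.1) :
    ∃ a : ℝ, Set.InjOn (fun p : ℝ × ℝ => p.2 + a * p.1) Q := by
  have hf : ((fun z : (ℝ × ℝ) × (ℝ × ℝ) => -(z.1.2 - z.2.2) / (z.1.1 - z.2.1)) '' (Q ×ˢ Q)).Finite :=
    (hQ.prod hQ).image _
  obtain ⟨a, ha⟩ := hf.infinite_compl.nonempty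
  refine ⟨a, ?_⟩
  intro p hp q hq h
  by_contra hne
  apply ha
  refine ⟨(p, q), ⟨hp, hq⟩, ?_⟩
  have := sub_ne_zero.mpr (hx p hp q hq hne)
  simp only at h ⊢
  rw [div_eq_iff this]
  linarith

theorem statement_5 (Q : Set (ℝ × ℝ)) (hQ : Q.Finite)
    (hx : ∀ p ∈ Q, ∀ p' ∈ Q, p ≠ p' → p.1 ≠ p'.1) (k : ℕ) :
    k ∈ ISet Q ↔
      ∃ a : ℝ, ({p : ℝ × ℝ | p.1 = a} ∩ ⋃ q ∈ Q, fline q).ncard = k := by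
  rw [iset_iff Q hQ]
  simp only [vert_ncard]
  constructor
  · rintro ⟨⟨v1, v2⟩, hv, rfl⟩
    by_cases h1 : v1 = 0
    · subst h1
      have h2 : v2 ≠ 0 := by
        rintro rfl
        exact hv rfl
      obtain ⟨a, ha⟩ := exists_generic Q hQ hx
      refine ⟨a, ?_⟩
      rw [Set.ncard_image_of_injOn ha, Set.ncard_image_of_injOn]
      intro p hp q hq h
      by_contra hne
      apply hx p hp q hq hne
      apply mul_left_cancel₀ h2
      simp only at h
      linarith
    · refine ⟨-v2 / v1, ?_⟩
      have : (fun p : ℝ × ℝ => v1 * p.2 - v2 * p.1) =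
          (fun c => v1 * c) ∘ (fun p : ℝ × ℝ => p.2 + -v2 / v1 * p.1) := by
        funext p
        simp only [Function.comp]
        field_simp
        ring
      simp only
      rw [this, Set.image_comp]
      symm
      exact Set.ncard_image_of_injective _ (mul_right_injective₀ h1)
  · rintro ⟨a, rfl⟩
    refine ⟨(1, -a), by simp, ?_⟩
    congr 2
    funext p
    simp only
    ring
end

section
/- Let k ≥ 2 and let q₀,…,q_{2k−1} ∈ ℝ² be the vertices of a regular 2k-gon (qⱼ = c + r·(cos(2πj/(2k) + θ), sin(2πj/(2k) + θ)) for some center c, radius r > 0, and angle θ). Then I({q₀,…,q_{2k−1}}) = {k, k+1, 2k}. -/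
def Lf (φ t : ℝ) : Set (ℝ × ℝ) := {p | p.1 * Real.cos φ + p.2 * Real.sin φ = t}

lemma Lf_eq (φ : ℝ) (b : ℝ × ℝ) :
    {p : ℝ × ℝ | ∃ t : ℝ, p = b + t • (-Real.sin φ, Real.cos φ)} =
      Lf φ (b.1 * Real.cos φ + b.2 * Real.sin φ) := by
  have h := Real.sin_sq_add_cos_sq φ
  ext ⟨x, y⟩
  obtain ⟨b1, b2⟩ := b
  simp only [Lf, Set.mem_setOf_eq, Prod.smul_mk, smul_eq_mul, Prod.mk_add_mk, Prod.mk.injEq]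
  constructor
  · rintro ⟨t, rfl, rfl⟩
    ring
  · intro e
    refine ⟨-(x - b1) * Real.sin φ + (y - b2) * Real.cos φ, ?_, ?_⟩
    · linear_combination (Real.cos φ) * e - (x - b1) * h
    · linear_combination (Real.sin φ) * e - (y - b2) * h

lemma Lf_pt (φ t : ℝ) : Lf φ t =
    {p : ℝ × ℝ | ∃ s : ℝ, p = (t * Real.cos φ, t * Real.sin φ) + s • (-Real.sin φ, Real.cos φ)} := by
  rw [Lf_eq]
  congr 1
  linear_combination (-t) * Real.sin_sq_add_cos_sq φ

lemma Lf_inj (φ : ℝ) : Function.Injective (Lf φ) := by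
  intro s t h
  have h1 : (s * Real.cos φ, s * Real.sin φ) ∈ Lf φ s := by
    simp only [Lf, Set.mem_setOf_eq]
    linear_combination s * Real.sin_sq_add_cos_sq φ
  have h2 := h1
  rw [h] at h2
  simp only [Lf, Set.mem_setOf_eq] at h1 h2
  linarith

lemma dir_ne (φ : ℝ) : ((-Real.sin φ, Real.cos φ) : ℝ × ℝ) ≠ 0 := by
  intro h
  rw [Prod.mk_eq_zero] at h
  have := Real.sin_sq_add_cos_sq φ
  have h1 : Real.sin φ = 0 := by linarith [h.1]
  rw [h1, h.2] at this
  norm_num at this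

lemma exists_dir (v : ℝ × ℝ) : ∃ ρ φ : ℝ, v = ρ • (-Real.sin φ, Real.cos φ) := by
  refine ⟨‖(⟨v.2, -v.1⟩ : ℂ)‖, Complex.arg ⟨v.2, -v.1⟩, ?_⟩
  have h1 := Complex.norm_mul_cos_arg (⟨v.2, -v.1⟩ : ℂ)
  have h2 := Complex.norm_mul_sin_arg (⟨v.2, -v.1⟩ : ℂ)
  simp only at h1 h2
  ext
  · simp only [Prod.smul_mk, smul_eq_mul]; linarith
  · simp only [Prod.smul_mk, smul_eq_mul]; linarith

lemma line_scale (b v w : ℝ × ℝ) (s : ℝ) (hs : s ≠ 0) (h : v = s • w) :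
    {p : ℝ × ℝ | ∃ t : ℝ, p = b + t • v} = {p : ℝ × ℝ | ∃ t : ℝ, p = b + t • w} := by
  ext p
  constructor
  · rintro ⟨t, rfl⟩
    exact ⟨t * s, by rw [h, smul_smul]⟩
  · rintro ⟨t, rfl⟩
    exact ⟨t / s, by rw [h, smul_smul, div_mul_cancel₀ _ hs]⟩

lemma fam {Q : Set (ℝ × ℝ)} (hQ : Q.Nonempty) (hf : Q.Finite) (n : ℕ) :
    n ∈ ISet Q ↔ ∃ φ : ℝ,
      n = ((fun p : ℝ × ℝ => p.1 * Real.cos φ + p.2 * Real.sin φ) '' Q).ncard := by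
  classical
  constructor
  · rintro ⟨G, rfl, hL, hP, hc, hm⟩
    obtain ⟨x, hx⟩ := hQ
    obtain ⟨L0, hL0, -⟩ := hc hx
    have hL0' : L0 ∈ G := hL0
    obtain ⟨a0, v0, hv0, e0⟩ := hL L0 hL0'
    obtain ⟨ρ, φ, hv⟩ := exists_dir v0
    have hρ : ρ ≠ 0 := by rintro rfl; simp at hv; exact hv0 hv
    have key : ∀ M ∈ G, ∃ t, M = Lf φ t := by
      intro M hM
      obtain ⟨a, b, v, hvne, eL, eM⟩ := hP L0 hL0' M hM
      have m1 : a0 ∈ L0 := by rw [e0]; exact ⟨0, by simp⟩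
      have m2 : a0 + v0 ∈ L0 := by rw [e0]; exact ⟨1, by simp⟩
      rw [eL] at m1 m2
      obtain ⟨t1, h1⟩ := m1
      obtain ⟨t2, h2⟩ := m2
      have h3 : v0 = (t2 - t1) • v := by
        have : v0 = (a0 + v0) - a0 := by abel
        rw [this, h2, h1, sub_smul]; abel
      have h4 : t2 - t1 ≠ 0 := by intro h; rw [h, zero_smul] at h3; exact hv0 h3
      refine ⟨b.1 * Real.cos φ + b.2 * Real.sin φ, ?_⟩
      rw [eM, ← line_scale b v0 v _ h4 h3, line_scale b v0 _ _ hρ hv, Lf_eq]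
    refine ⟨φ, ?_⟩
    rw [← Set.ncard_image_of_injective _ (Lf_inj φ), ← Set.ncard_coe_finset]
    congr 1
    ext M
    constructor
    · intro hM
      obtain ⟨t, rfl⟩ := key M hM
      obtain ⟨y, hy1, hy2⟩ := hm _ hM
      exact ⟨t, ⟨y, hy2, hy1⟩, rfl⟩
    · rintro ⟨_, ⟨y, hy, rfl⟩, rfl⟩
      obtain ⟨M, hM, hyM⟩ := hc hy
      obtain ⟨t, rfl⟩ := key M hM
      have : y.1 * Real.cos φ + y.2 * Real.sin φ = t := hyM
      simp only [this]
      exact hM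
  · rintro ⟨φ, rfl⟩
    have hfin : (Lf φ '' ((fun p : ℝ × ℝ => p.1 * Real.cos φ + p.2 * Real.sin φ) '' Q)).Finite :=
      (hf.image _).image _
    refine ⟨hfin.toFinset, ?_, ?_, ?_, ?_, ?_⟩
    · rw [← Set.ncard_eq_toFinset_card _ hfin, Set.ncard_image_of_injective _ (Lf_inj φ)]
    · intro L hL
      rw [Set.Finite.mem_toFinset] at hL
      obtain ⟨t, -, rfl⟩ := hL
      exact ⟨_, _, dir_ne φ, Lf_pt φ t⟩
    · intro L hL M hM
      rw [Set.Finite.mem_toFinset] at hL hM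
      obtain ⟨t, -, rfl⟩ := hL
      obtain ⟨s, -, rfl⟩ := hM
      exact ⟨_, _, _, dir_ne φ, Lf_pt φ t, Lf_pt φ s⟩
    · intro y hy
      refine ⟨Lf φ (y.1 * Real.cos φ + y.2 * Real.sin φ), ?_, rfl⟩
      rw [Set.Finite.coe_toFinset]
      exact ⟨_, ⟨y, hy, rfl⟩, rfl⟩
    · intro L hL
      rw [Set.Finite.mem_toFinset] at hL
      obtain ⟨_, ⟨y, hy, rfl⟩, rfl⟩ := hL
      exact ⟨y, rfl, hy⟩

def VS (k : ℕ) (α : ℝ) : Set ℝ :=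
  Set.range (fun j : Fin (2 * k) => Real.cos (Real.pi * ((j : ℕ) : ℝ) / k + α))

lemma cos_red (k : ℕ) (hk : 2 ≤ k) (α : ℝ) (z : ℤ) (s c : ℤ) (h : z = s + 2 * k * c) :
    Real.cos (Real.pi * z / k + α) = Real.cos (Real.pi * s / k + α) := by
  have hk0 : (k : ℝ) ≠ 0 := by positivity
  have : Real.pi * z / k + α = (Real.pi * s / k + α) + c * (2 * Real.pi) := by
    rw [h]; push_cast; field_simp; ring
  rw [this, Real.cos_add_int_mul_two_pi]

lemma VS_int (k : ℕ) (hk : 2 ≤ k) (α : ℝ) :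
    VS k α = Set.range (fun z : ℤ => Real.cos (Real.pi * z / k + α)) := by
  ext x
  constructor
  · rintro ⟨j, rfl⟩
    exact ⟨(j : ℕ), by simp⟩
  · rintro ⟨z, rfl⟩
    have h1 := Int.emod_nonneg z (b := 2 * k) (by omega)
    have h2 := Int.emod_lt_of_pos z (b := 2 * k) (by omega)
    have h3 := Int.emod_add_mul_ediv z (2 * k)
    refine ⟨⟨(z % (2 * k)).toNat, by omega⟩, ?_⟩
    simp only
    rw [cos_red k hk α z (z % (2 * k)) (z / (2 * k)) h3.symm]
    have : (((z % (2 * k)).toNat : ℕ) : ℝ) = ((z % (2 * k) : ℤ) : ℝ) := by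
      exact_mod_cast Int.toNat_of_nonneg h1
    rw [this]

lemma VS_shift (k : ℕ) (hk : 2 ≤ k) (α : ℝ) (m : ℤ) :
    VS k (Real.pi * m / k + α) = VS k α := by
  rw [VS_int k hk, VS_int k hk]
  ext x
  constructor
  · rintro ⟨z, rfl⟩
    exact ⟨z + m, by simp only; congr 1; push_cast; ring⟩
  · rintro ⟨z, rfl⟩
    exact ⟨z - m, by simp only; congr 1; push_cast; ring⟩

/-- Both symmetric cases at once: `e = 0` gives `k + 1` values, `e = 1` gives `k`. -/
lemma VS_sym (k : ℕ) (hk : 2 ≤ k) (e : ℕ) (he : e ≤ 1) :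
    (VS k (Real.pi * e / (2 * k))).ncard = k + 1 - e := by
  have hk0 : (0 : ℝ) < k := by positivity
  have hpi := Real.pi_pos
  have hset : VS k (Real.pi * e / (2 * k)) =
      (fun j : ℕ => Real.cos (Real.pi * j / k + Real.pi * e / (2 * k))) ''
        (Finset.range (k + 1 - e) : Set ℕ) := by
    ext x
    constructor
    · rintro ⟨⟨j, hj⟩, rfl⟩
      by_cases h : j < k + 1 - e
      · exact ⟨j, by simpa using h, rfl⟩
      · refine ⟨2 * k - e - j, by simp; omega, ?_⟩
        simp only
        have : ((2 * k - e - j : ℕ) : ℝ) = 2 * k - e - j := by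
          rw [Nat.cast_sub (by omega), Nat.cast_sub (by omega)]; push_cast; ring
        rw [this, ← Real.cos_two_pi_sub]
        congr 1
        field_simp
        ring
    · rintro ⟨j, hj, rfl⟩
      have hj' : j < k + 1 - e := by simpa using hj
      exact ⟨⟨j, by omega⟩, rfl⟩
  rw [hset, Set.ncard_image_of_injOn, Set.ncard_coe_finset, Finset.card_range]
  have mem : ∀ j : ℕ, j < k + 1 - e →
      Real.pi * j / k + Real.pi * e / (2 * k) ∈ Set.Icc 0 Real.pi := by
    intro j hj
    refine ⟨by positivity, ?_⟩
    have h1 : ((2 * j + e : ℕ) : ℝ) ≤ ((2 * k : ℕ) : ℝ) := by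
      exact_mod_cast (by omega : 2 * j + e ≤ 2 * k)
    push_cast at h1
    have : Real.pi * j / k + Real.pi * e / (2 * k) = Real.pi * ((2 * j + e) / (2 * k)) := by
      field_simp
    rw [this]
    have : (2 * (j : ℝ) + e) / (2 * k) ≤ 1 := by rw [div_le_one (by positivity)]; exact h1
    nlinarith
  intro i hi j hj hij
  have := Real.injOn_cos (mem i (by simpa using hi)) (mem j (by simpa using hj)) hij
  have h2 : Real.pi * i / k = Real.pi * j / k := by linarith
  field_simp at h2
  exact_mod_cast h2

lemma VS_gen (k : ℕ) (hk : 2 ≤ k) (α : ℝ) (h : ∀ m : ℤ, α ≠ Real.pi * m / (2 * k)) :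
    (VS k α).ncard = 2 * k := by
  have hk0 : (k : ℝ) ≠ 0 := by positivity
  have hpi := Real.pi_pos.ne'
  have inj : Function.Injective
      (fun j : Fin (2 * k) => Real.cos (Real.pi * ((j : ℕ) : ℝ) / k + α)) := by
    intro i j hij
    rw [Real.cos_eq_cos_iff] at hij
    obtain ⟨c, hc | hc⟩ := hij
    · have h1 : ((j : ℕ) : ℝ) = 2 * k * c + (i : ℕ) := by
        field_simp at hc
        have : Real.pi * ((j : ℕ) : ℝ) = Real.pi * (2 * k * c + (i : ℕ)) := by
          linarith
        exact mul_left_cancel₀ hpi this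
      have h2 : ((j : ℕ) : ℤ) = 2 * k * c + (i : ℕ) := by exact_mod_cast h1
      have hi := i.2
      have hj := j.2
      have hc0 : c = 0 := by
        have : c < 1 := by by_contra hh; nlinarith
        have : -1 < c := by by_contra hh; nlinarith
        omega
      subst hc0
      ext
      omega
    · exfalso
      refine h (2 * k * c - i - j) ?_
      push_cast
      field_simp at hc ⊢
      linarith
  rw [VS, ← Set.image_univ, Set.ncard_image_of_injective _ inj, Set.ncard_univ]
  simp

theorem statement_6 (k : ℕ) (hk : 2 ≤ k) (q : Fin (2 * k) → ℝ × ℝ)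
    (c : ℝ × ℝ) (r θ : ℝ) (hr : 0 < r)
    (hq : ∀ j : Fin (2 * k), q j = c + r •
      (Real.cos (2 * Real.pi * ((j : ℕ) : ℝ) / (2 * (k : ℝ)) + θ),
       Real.sin (2 * Real.pi * ((j : ℕ) : ℝ) / (2 * (k : ℝ)) + θ))) :
    ISet (Set.range q) = {k, k + 1, 2 * k} := by

  have hk0 : (0 : ℝ) < k := by positivity
  have hpi := Real.pi_pos
  have hn : ∀ φ : ℝ, ((fun p : ℝ × ℝ => p.1 * Real.cos φ + p.2 * Real.sin φ) ''
      (Set.range q)).ncard = (VS k (θ - φ)).ncard := by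
    intro φ
    have inj : Function.Injective
        (fun x : ℝ => (c.1 * Real.cos φ + c.2 * Real.sin φ) + r * x) := by
      intro x y hxy
      simpa [hr.ne'] using hxy
    rw [← Set.ncard_image_of_injective (VS k (θ - φ)) inj, VS, ← Set.range_comp, ← Set.range_comp]
    congr 2
    ext j
    have : Real.pi * ((j : ℕ) : ℝ) / k + (θ - φ) =
      (2 * Real.pi * ((j : ℕ) : ℝ) / (2 * (k : ℝ)) + θ) - φ := by field_simp; ring
    simp only [Function.comp, hq, this, Real.cos_sub, Prod.fst_add, Prod.snd_add,
      Prod.smul_mk, smul_eq_mul]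
    ring
  ext n
  have hne : (Set.range q).Nonempty := ⟨_, ⟨⟨0, by omega⟩, rfl⟩⟩
  rw [fam hne (Set.finite_range q)]
  simp only [hn, Set.mem_insert_iff, Set.mem_singleton_iff]
  have s0 := VS_sym k hk 0 (by norm_num)
  have s1 := VS_sym k hk 1 (by norm_num)
  constructor
  · rintro ⟨φ, rfl⟩
    by_cases h : ∃ m : ℤ, θ - φ = Real.pi * m / (2 * k)
    · obtain ⟨m, hm⟩ := h
      rcases Int.even_or_odd' m with ⟨d, rfl | rfl⟩
      · have : θ - φ = Real.pi * d / k + Real.pi * (0 : ℕ) / (2 * k) := by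
          rw [hm]; push_cast; field_simp; ring
        rw [this, VS_shift k hk, s0]; omega
      · have : θ - φ = Real.pi * d / k + Real.pi * (1 : ℕ) / (2 * k) := by
          rw [hm]; push_cast; field_simp
        rw [this, VS_shift k hk, s1]; omega
    · push Not at h
      right; right
      exact VS_gen k hk _ h
  · rintro (rfl | rfl | rfl)
    · exact ⟨θ - Real.pi * (1 : ℕ) / (2 * n), by rw [sub_sub_cancel, s1]; omega⟩
    · exact ⟨θ - Real.pi * (0 : ℕ) / (2 * k), by rw [sub_sub_cancel, s0]; omega⟩
    · refine ⟨θ - Real.pi / (4 * k), ?_⟩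
      rw [sub_sub_cancel, VS_gen k hk]
      intro m hm
      field_simp at hm
      have : (2 : ℤ) * (2 * m) = 2 := by
        have : (2 : ℝ) * (2 * m) = 2 := by linarith
        exact_mod_cast this
      omega
end

section
/- Let k ≥ 1 and let q₀,…,q_{2k} ∈ ℝ² be the vertices of a regular (2k+1)-gon (qⱼ = c + r·(cos(2πj/(2k+1) + θ), sin(2πj/(2k+1) + θ)) for some center c, radius r > 0, and angle θ). Then I({q₀,…,q_{2k}}) = {k+1, 2k+1}; that is, any family of pairwise parallel lines covering the vertices, each line meeting at least one vertex, has exactly k+1 or exactly 2k+1 members, and both values occur. -/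
def phi (v p : ℝ × ℝ) : ℝ := v.2 * p.1 - v.1 * p.2

def FL (v : ℝ × ℝ) (c : ℝ) : Set (ℝ × ℝ) := {p | phi v p = c}

theorem line_eq (a v : ℝ × ℝ) (hv : v ≠ 0) :
    {p : ℝ × ℝ | ∃ t : ℝ, p = a + t • v} = FL v (phi v a) := by
  obtain ⟨a1, a2⟩ := a
  obtain ⟨v1, v2⟩ := v
  ext ⟨p1, p2⟩
  simp only [FL, phi, Set.mem_setOf_eq, Prod.smul_mk, Prod.mk_add_mk, Prod.mk.injEq, smul_eq_mul]
  constructor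
  · rintro ⟨t, rfl, rfl⟩
    ring
  · intro h
    by_cases h1 : v1 = 0
    · subst h1
      have h2 : v2 ≠ 0 := by
        rintro rfl
        exact hv rfl
      refine ⟨(p2 - a2) / v2, ?_, ?_⟩
      · have : v2 * (p1 - a1) = 0 := by linarith
        rcases mul_eq_zero.mp this with h | h
        · exact absurd h h2
        · linarith
      · field_simp
        ring
    · refine ⟨(p1 - a1) / v1, ?_, ?_⟩
      · field_simp
        ring
      · field_simp
        linarith

theorem phi_surj (v : ℝ × ℝ) (hv : v ≠ 0) (c : ℝ) : ∃ p, phi v p = c := by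
  obtain ⟨v1, v2⟩ := v
  by_cases h1 : v1 = 0
  · subst h1
    have h2 : v2 ≠ 0 := by
      rintro rfl
      exact hv rfl
    exact ⟨(c / v2, 0), by simp [phi]; field_simp⟩
  · exact ⟨(0, -c / v1), by simp [phi]; field_simp⟩

theorem FL_inj (v : ℝ × ℝ) (hv : v ≠ 0) : Function.Injective (FL v) := by
  intro c d h
  obtain ⟨p, hp⟩ := phi_surj v hv c
  have : p ∈ FL v c := hp
  rw [h] at this
  exact hp.symm.trans this

theorem mem_ISet {n : ℕ} [NeZero n] (q : Fin n → ℝ × ℝ) (N : ℕ) :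
    N ∈ ISet (Set.range q) ↔
      ∃ v : ℝ × ℝ, v ≠ 0 ∧ (Finset.univ.image (fun j => phi v (q j))).card = N := by
  classical
  constructor
  · rintro ⟨G, rfl, -, hpar, hcov, hmeet⟩
    obtain ⟨L0, hL0, -⟩ := hcov (Set.mem_range_self (0 : Fin n))
    obtain ⟨a, -, v, hv, hL0v, -⟩ := hpar L0 hL0 L0 hL0
    have key : ∀ L ∈ G, ∃ d, L = FL v d := by
      intro L hL
      obtain ⟨a', b, w, hw, h1, h2⟩ := hpar L0 hL0 L hL
      have e1 : a ∈ L0 := by rw [hL0v]; exact ⟨0, by simp⟩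
      have e2 : a + v ∈ L0 := by rw [hL0v]; exact ⟨1, by simp⟩
      rw [h1] at e1 e2
      obtain ⟨t1, ht1⟩ := e1
      obtain ⟨t2, ht2⟩ := e2
      have hvw : v = (t2 - t1) • w := by
        rw [sub_smul]
        have : v = (a + v) - a := by simp
        rw [this, ht2, ht1]
        abel
      have ht : t2 - t1 ≠ 0 := by
        intro h
        rw [h, zero_smul] at hvw
        exact hv hvw
      refine ⟨phi v b, ?_⟩
      rw [h2, line_eq b w hw]
      have hphi : ∀ p, phi v p = (t2 - t1) * phi w p := by
        intro p
        rw [hvw]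
        simp [phi]
        ring
      ext p
      simp only [FL, Set.mem_setOf_eq, hphi]
      exact ⟨fun h => by rw [h], fun h => mul_left_cancel₀ ht h⟩
    refine ⟨v, hv, ?_⟩
    rw [← Finset.card_image_of_injective _ (FL_inj v hv)]
    congr 1
    ext L
    simp only [Finset.mem_image, Finset.mem_univ, true_and, exists_exists_eq_and]
    constructor
    · rintro ⟨j, rfl⟩
      obtain ⟨L, hL, hj⟩ := hcov (Set.mem_range_self j)
      obtain ⟨d, rfl⟩ := key L hL
      have : phi v (q j) = d := hj
      rw [this]
      exact hL
    · intro hL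
      obtain ⟨d, rfl⟩ := key L hL
      obtain ⟨p, hp, j, rfl⟩ := hmeet _ hL
      refine ⟨j, ?_⟩
      have : phi v (q j) = d := hp
      rw [this]
  · rintro ⟨v, hv, rfl⟩
    refine ⟨(Finset.univ.image (fun j => phi v (q j))).image (FL v), 
      Finset.card_image_of_injective _ (FL_inj v hv), ?_, ?_, ?_, ?_⟩
    · intro L hL
      simp only [Finset.mem_image, Finset.mem_univ, true_and, exists_exists_eq_and] at hL
      obtain ⟨j, rfl⟩ := hL
      exact ⟨q j, v, hv, (line_eq _ _ hv).symm⟩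
    · intro L hL M hM
      simp only [Finset.mem_image, Finset.mem_univ, true_and, exists_exists_eq_and] at hL hM
      obtain ⟨j, rfl⟩ := hL
      obtain ⟨i, rfl⟩ := hM
      exact ⟨q j, q i, v, hv, (line_eq _ _ hv).symm, (line_eq _ _ hv).symm⟩
    · rintro _ ⟨j, rfl⟩
      refine ⟨FL v (phi v (q j)), ?_, rfl⟩
      simp
    · intro L hL
      simp only [Finset.mem_image, Finset.mem_univ, true_and, exists_exists_eq_and] at hL
      obtain ⟨j, rfl⟩ := hL
      exact ⟨q j, rfl, j, rfl⟩

def CC (k : ℕ) (β : ℝ) (s : ℤ) : Prop := Real.cos (β - Real.pi * s / (2 * k + 1)) = 0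

theorem CC_iff (k : ℕ) (β : ℝ) (s : ℤ) :
    CC k β s ↔ ∃ z : ℤ, β * (2 * (2 * k + 1)) = Real.pi * ((2 * z + 1) * (2 * k + 1) + 2 * s) := by
  unfold CC
  have hn : (2 * (k : ℝ) + 1) ≠ 0 := by positivity
  rw [Real.cos_eq_zero_iff]
  refine exists_congr fun z => ?_
  constructor
  · intro h
    have : β = (2 * z + 1) * Real.pi / 2 + Real.pi * s / (2 * k + 1) := by linarith
    rw [this]
    field_simp
    try ring
  · intro h
    field_simp
    linarith

theorem CC_dvd {k : ℕ} {β : ℝ} {s t : ℤ} (hs : CC k β s) : CC k β t ↔ (2 * k + 1 : ℤ) ∣ t - s := by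
  rw [CC_iff] at *
  obtain ⟨z, hz⟩ := hs
  constructor
  · rintro ⟨w, hw⟩
    rw [hz] at hw
    have := mul_left_cancel₀ Real.pi_ne_zero hw
    have h2 : ((2 * z + 1) * (2 * k + 1) + 2 * s : ℤ) = (2 * w + 1) * (2 * k + 1) + 2 * t := by
      exact_mod_cast this
    exact ⟨z - w, by linarith⟩
  · rintro ⟨w, hw⟩
    have : (t : ℝ) = s + (2 * k + 1) * w := by
      have : t = s + (2 * k + 1) * w := by linarith
      exact_mod_cast this
    refine ⟨z - w, ?_⟩
    rw [hz, this]
    push_cast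
    ring

theorem g_eq (k : ℕ) (A B β : ℝ) (hB : B ≠ 0) (g : ℤ → ℝ)
    (hg : ∀ m : ℤ, g m = A + B * Real.sin (β - 2 * Real.pi * m / (2 * k + 1))) (m l : ℤ) :
    g m = g l ↔ (2 * k + 1 : ℤ) ∣ m - l ∨ CC k β (m + l) := by
  have hn : (2 * (k : ℝ) + 1) ≠ 0 := by positivity
  rw [hg, hg, add_right_inj, mul_right_inj' hB, ← sub_eq_zero, Real.sin_sub_sin]
  have e1 : (β - 2 * Real.pi * m / (2 * k + 1) + (β - 2 * Real.pi * l / (2 * k + 1))) / 2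
      = β - Real.pi * ((m + l : ℤ) : ℝ) / (2 * k + 1) := by
    push_cast; field_simp; ring
  have e2 : (β - 2 * Real.pi * m / (2 * k + 1) - (β - 2 * Real.pi * l / (2 * k + 1))) / 2
      = Real.pi * (l - m) / (2 * k + 1) := by
    field_simp; ring
  rw [e1, e2, mul_eq_zero, mul_eq_zero]
  simp only [OfNat.ofNat_ne_zero, false_or]
  refine or_congr ?_ Iff.rfl
  rw [Real.sin_eq_zero_iff]
  constructor
  · rintro ⟨z, hz⟩
    field_simp at hz
    refine ⟨-z, ?_⟩
    have : (z : ℤ) * (2 * k + 1) = l - m := by exact_mod_cast hz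
    linarith
  · rintro ⟨z, hz⟩
    refine ⟨-z, ?_⟩
    field_simp
    have : ((m - l : ℤ) : ℝ) = ((2 * k + 1) * z : ℤ) := by rw [hz]
    push_cast at this ⊢
    linarith

theorem count1 (k : ℕ) (β : ℝ) (g : ℤ → ℝ)
    (h : ∀ m l : ℤ, g m = g l ↔ (2 * k + 1 : ℤ) ∣ m - l ∨ CC k β (m + l))
    (hC : ∀ s, ¬ CC k β s) :
    (Finset.univ.image (fun j : Fin (2 * k + 1) => g ((j : ℕ) : ℤ))).card = 2 * k + 1 := by
  rw [Finset.card_image_of_injective]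
  · simp
  · intro i j hij
    rcases (h _ _).mp hij with h1 | h1
    · have := Int.eq_zero_of_abs_lt_dvd h1 (by rw [abs_lt]; omega)
      omega
    · exact absurd h1 (hC _)

theorem count2 (k : ℕ) (β : ℝ) (g : ℤ → ℝ)
    (h : ∀ m l : ℤ, g m = g l ↔ (2 * k + 1 : ℤ) ∣ m - l ∨ CC k β (m + l))
    (hC : ∃ s, CC k β s) :
    (Finset.univ.image (fun j : Fin (2 * k + 1) => g ((j : ℕ) : ℤ))).card = k + 1 := by
  have hx : ∃ x : ℤ, CC k β (2 * x) := by
    obtain ⟨s, hs⟩ := hC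
    rcases Int.even_or_odd' s with ⟨x, rfl | rfl⟩
    · exact ⟨x, hs⟩
    · exact ⟨x + k + 1, (CC_dvd hs).mpr ⟨1, by ring⟩⟩
  obtain ⟨x, hx⟩ := hx
  have h' : ∀ m l : ℤ, g m = g l ↔ (2 * k + 1 : ℤ) ∣ m - l ∨ (2 * k + 1 : ℤ) ∣ m + l - 2 * x := by
    intro m l
    rw [h, CC_dvd hx]
  have him : Finset.univ.image (fun j : Fin (2 * k + 1) => g ((j : ℕ) : ℤ)) =
      (Finset.range (k + 1)).image (fun t : ℕ => g (x + t)) := by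
    ext y
    simp only [Finset.mem_image, Finset.mem_univ, true_and, Finset.mem_range]
    have hn : (0 : ℤ) < 2 * k + 1 := by positivity
    constructor
    · rintro ⟨j, rfl⟩
      set u : ℤ := ((j : ℕ) : ℤ) - x with hu
      have a1 := Int.emod_nonneg u hn.ne'
      have a2 := Int.emod_lt_of_pos u hn
      have a3 := Int.mul_ediv_add_emod u (2 * k + 1)
      by_cases hle : u % (2 * k + 1) ≤ k
      · refine ⟨(u % (2 * k + 1)).toNat, by omega, ?_⟩
        rw [Int.toNat_of_nonneg a1, h']
        left
        exact ⟨-(u / (2 * k + 1)), by linarith⟩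
      · refine ⟨(2 * k + 1 - u % (2 * k + 1)).toNat, by omega, ?_⟩
        rw [Int.toNat_of_nonneg (by omega), h']
        right
        exact ⟨(u / (2 * k + 1)) + 1, by linarith⟩
    · rintro ⟨t, ht, rfl⟩
      have a1 := Int.emod_nonneg (x + t) hn.ne'
      have a2 := Int.emod_lt_of_pos (x + t) hn
      have a3 := Int.mul_ediv_add_emod (x + t) (2 * k + 1)
      refine ⟨⟨((x + t) % (2 * k + 1)).toNat, by omega⟩, ?_⟩
      simp only
      rw [Int.toNat_of_nonneg a1, h']
      left
      exact ⟨-((x + t) / (2 * k + 1)), by linarith⟩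
  rw [him, Finset.card_image_of_injOn]
  · simp
  · intro i hi j hj hij
    simp only [Finset.coe_range, Set.mem_Iio] at hi hj
    rcases (h' _ _).mp hij with h1 | h1
    · have := Int.eq_zero_of_abs_lt_dvd h1 (by rw [abs_lt]; omega)
      omega
    · have := Int.eq_zero_of_abs_lt_dvd h1 (by rw [abs_lt]; omega)
      omega

theorem exists_polar (v : ℝ × ℝ) (hv : v ≠ 0) :
    ∃ ρ α : ℝ, ρ ≠ 0 ∧ v = (ρ * Real.cos α, ρ * Real.sin α) := by
  refine ⟨‖(⟨v.1, v.2⟩ : ℂ)‖, Complex.arg ⟨v.1, v.2⟩, ?_, ?_⟩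
  · intro h
    rw [norm_eq_zero] at h
    apply hv
    have h1 := congrArg Complex.re h
    have h2 := congrArg Complex.im h
    exact Prod.ext h1 h2
  · rw [Complex.norm_mul_cos_arg, Complex.norm_mul_sin_arg]

theorem statement_7 (k : ℕ) (hk : 1 ≤ k) (q : Fin (2 * k + 1) → ℝ × ℝ)
    (c : ℝ × ℝ) (r θ : ℝ) (hr : 0 < r)
    (hq : ∀ j : Fin (2 * k + 1), q j = c + r •
      (Real.cos (2 * Real.pi * ((j : ℕ) : ℝ) / (2 * (k : ℝ) + 1) + θ),
       Real.sin (2 * Real.pi * ((j : ℕ) : ℝ) / (2 * (k : ℝ) + 1) + θ))) :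
    ISet (Set.range q) = {k + 1, 2 * k + 1} := by
  have hphi : ∀ ρ α : ℝ, ρ ≠ 0 → ∃ g : ℤ → ℝ,
      (∀ m l : ℤ, g m = g l ↔ (2 * k + 1 : ℤ) ∣ m - l ∨ CC k (α - θ) (m + l)) ∧
      (fun j => phi (ρ * Real.cos α, ρ * Real.sin α) (q j)) = fun j : Fin (2 * k + 1) => g ((j : ℕ) : ℤ) := by
    intro ρ α hρ
    refine ⟨fun m => phi (ρ * Real.cos α, ρ * Real.sin α) c +
      (ρ * r) * Real.sin (α - θ - 2 * Real.pi * m / (2 * k + 1)), ?_, ?_⟩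
    · exact g_eq k _ _ _ (mul_ne_zero hρ hr.ne') _ (fun m => rfl)
    · funext j
      rw [hq j]
      have : α - θ - 2 * Real.pi * (((j : ℕ) : ℤ) : ℝ) / (2 * k + 1) =
        α - (2 * Real.pi * ((j : ℕ) : ℝ) / (2 * (k : ℝ) + 1) + θ) := by
        push_cast; ring
      simp only [this]
      rw [Real.sin_sub]
      simp [phi]
      ring
  have hne : ∀ α : ℝ, ((1 * Real.cos α, 1 * Real.sin α) : ℝ × ℝ) ≠ 0 := by
    intro α h
    have h1 := congrArg Prod.fst h
    have h2 := congrArg Prod.snd h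
    simp at h1 h2
    have := Real.sin_sq_add_cos_sq α
    rw [h1, h2] at this
    norm_num at this
  ext N
  rw [mem_ISet]
  simp only [Set.mem_insert_iff, Set.mem_singleton_iff]
  constructor
  · rintro ⟨v, hv, rfl⟩
    obtain ⟨ρ, α, hρ, rfl⟩ := exists_polar v hv
    obtain ⟨g, hg, he⟩ := hphi ρ α hρ
    rw [he]
    by_cases hC : ∃ s, CC k (α - θ) s
    · exact Or.inl (count2 k _ g hg hC)
    · exact Or.inr (count1 k _ g hg (not_exists.mp hC))
  · rintro (rfl | rfl)
    · obtain ⟨g, hg, he⟩ := hphi 1 (θ + Real.pi / 2) one_ne_zero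
      refine ⟨_, hne (θ + Real.pi / 2), ?_⟩
      rw [he]
      refine count2 k _ g hg ⟨0, ?_⟩
      simp [CC]
    · set α := θ + Real.pi / 2 + Real.pi / (2 * (2 * k + 1)) with hα
      obtain ⟨g, hg, he⟩ := hphi 1 α one_ne_zero
      refine ⟨_, hne α, ?_⟩
      rw [he]
      refine count1 k _ g hg ?_
      intro s hs
      rw [CC_iff] at hs
      obtain ⟨z, hz⟩ := hs
      have hn : (2 * (k : ℝ) + 1) ≠ 0 := by positivity
      have : (α - θ) * (2 * (2 * k + 1)) = Real.pi * ((2 * k + 1) + 1) := by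
        rw [hα]; field_simp; ring
      rw [this] at hz
      have h1 := mul_left_cancel₀ Real.pi_ne_zero hz
      have h2 : ((2 * k + 1) + 1 : ℤ) = (2 * z + 1) * (2 * k + 1) + 2 * s := by exact_mod_cast h1
      have h3 : (1 : ℤ) = 2 * (z * (2 * k + 1) + s) := by linarith
      omega
end

section
/- Let k ≥ 1, let q₀,…,q_{4k+1} ∈ ℝ² be the vertices of a regular (4k+2)-gon with center q (i.e., qⱼ = q + r·(cos(2πj/(4k+2) + θ), sin(2πj/(4k+2) + θ)), r > 0). Then I({q, q₀,…,q_{4k+1}}) = {2k+1, 2k+3, 4k+3}. -/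
noncomputable def prj (φ : ℝ) (p : ℝ × ℝ) : ℝ := Real.cos φ * p.1 + Real.sin φ * p.2

lemma level_isLine (φ : ℝ) (p : ℝ × ℝ) :
    {x : ℝ × ℝ | prj φ x = prj φ p} =
      {x : ℝ × ℝ | ∃ t : ℝ, x = p + t • (-Real.sin φ, Real.cos φ)} := by
  ext x
  simp only [Set.mem_setOf_eq, prj]
  have h1 := Real.sin_sq_add_cos_sq φ
  constructor
  · intro h
    refine ⟨-Real.sin φ * (x.1 - p.1) + Real.cos φ * (x.2 - p.2), ?_⟩
    ext
    · simp only [Prod.fst_add, Prod.smul_fst, smul_eq_mul]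
      linear_combination Real.cos φ * h - (x.1 - p.1) * h1
    · simp only [Prod.snd_add, Prod.smul_snd, smul_eq_mul]
      linear_combination Real.sin φ * h - (x.2 - p.2) * h1
  · rintro ⟨t, rfl⟩
    simp
    ring

lemma dir_exists (v : ℝ × ℝ) (hv : v ≠ 0) :
    ∃ φ s : ℝ, s ≠ 0 ∧ v = s • ((-Real.sin φ, Real.cos φ) : ℝ × ℝ) := by
  have hz : (⟨v.2, -v.1⟩ : ℂ) ≠ 0 := by
    intro h
    apply hv
    have h1 := congrArg Complex.re h
    have h2 := congrArg Complex.im h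
    simp at h1 h2
    ext <;> simp [h1, h2]
  refine ⟨Complex.arg ⟨v.2, -v.1⟩, ‖(⟨v.2, -v.1⟩ : ℂ)‖, by simpa using hz, ?_⟩
  have h1 := Complex.norm_mul_cos_arg ⟨v.2, -v.1⟩
  have h2 := Complex.norm_mul_sin_arg ⟨v.2, -v.1⟩
  ext
  · simp only [Prod.smul_fst, smul_eq_mul, mul_neg]; rw [h2]; simp
  · simp only [Prod.smul_snd, smul_eq_mul]; rw [h1]

lemma mem_ISet_s8 (Q : Set (ℝ × ℝ)) (hQ : Q.Finite) (hne : Q.Nonempty) (n : ℕ) :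
    n ∈ ISet Q ↔ ∃ φ, (prj φ '' Q).ncard = n := by
  classical
  constructor
  · rintro ⟨G, rfl, hl, hp, hc, hm⟩
    obtain ⟨p0, hp0⟩ := hne
    obtain ⟨L0, hL0, -⟩ := hc hp0
    obtain ⟨a0, v0, hv0, e0⟩ := hl L0 hL0
    obtain ⟨φ, s, hs, e⟩ := dir_exists v0 hv0
    refine ⟨φ, ?_⟩
    have key : ∀ L ∈ G, ∀ x ∈ L, L = {y | prj φ y = prj φ x} := by
      intro L hL x hx
      obtain ⟨a, b, v, hv, e1, e2⟩ := hp L0 hL0 L hL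
      obtain ⟨u, hu0, hu⟩ : ∃ u : ℝ, u ≠ 0 ∧ v = u • ((-Real.sin φ, Real.cos φ) : ℝ × ℝ) := by
        have m1 : a ∈ L0 := by rw [e1]; exact ⟨0, by simp⟩
        have m2 : a + v ∈ L0 := by rw [e1]; exact ⟨1, by simp⟩
        rw [e0] at m1 m2
        obtain ⟨t1, h1⟩ := m1
        obtain ⟨t2, h2⟩ := m2
        have hv' : v = (t2 - t1) • v0 := by
          have : v = (a + v) - a := by simp
          rw [this, h2, h1]
          module
        have hv'' : v = ((t2 - t1) * s) • ((-Real.sin φ, Real.cos φ) : ℝ × ℝ) := by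
          rw [hv', e, smul_smul]
        refine ⟨(t2 - t1) * s, ?_, hv''⟩
        intro h0
        rw [h0, zero_smul] at hv''
        exact hv hv''
      rw [level_isLine]
      rw [e2] at hx
      obtain ⟨t, rfl⟩ := hx
      rw [e2, hu]
      ext y
      simp only [Set.mem_setOf_eq]
      constructor
      · rintro ⟨w, rfl⟩
        exact ⟨(w - t) * u, by module⟩
      · rintro ⟨w, rfl⟩
        refine ⟨t + w / u, ?_⟩
        rw [add_smul, add_assoc, smul_smul (w / u), div_mul_cancel₀ _ hu0]
    have hG : (G : Set (Set (ℝ × ℝ))) = (fun c => {y | prj φ y = c}) '' (prj φ '' Q) := by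
      ext L
      constructor
      · intro hL
        obtain ⟨x, hx, hxQ⟩ := hm L hL
        exact ⟨_, ⟨x, hxQ, rfl⟩, (key L hL x hx).symm⟩
      · rintro ⟨_, ⟨x, hxQ, rfl⟩, rfl⟩
        obtain ⟨L, hL, hx⟩ := hc hxQ
        have := key L hL x hx
        simp only
        rw [← this]
        exact hL
    rw [← Set.ncard_coe_finset, hG]
    refine (Set.InjOn.ncard_image ?_).symm
    rintro _ ⟨x, hx, rfl⟩ c _ h
    have : x ∈ {y | prj φ y = prj φ x} := rfl
    simp only at h
    rw [h] at this
    exact this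
  · rintro ⟨φ, rfl⟩
    have hf : ((fun c => {y | prj φ y = c}) '' (prj φ '' Q)).Finite := (hQ.image _).image _
    refine ⟨hf.toFinset, ?_, ?_, ?_, ?_, ?_⟩
    · rw [← Set.ncard_eq_toFinset_card _ hf, Set.ncard_image_of_injOn]
      rintro _ ⟨x, hx, rfl⟩ c _ h
      have : x ∈ {y | prj φ y = prj φ x} := rfl
      simp only at h
      rw [h] at this
      exact this
    · intro L hL
      rw [Set.Finite.mem_toFinset] at hL
      obtain ⟨_, ⟨x, hxQ, rfl⟩, rfl⟩ := hL
      exact ⟨x, _, dir_ne φ, level_isLine φ x⟩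
    · intro L hL M hM
      rw [Set.Finite.mem_toFinset] at hL hM
      obtain ⟨_, ⟨x, hxQ, rfl⟩, rfl⟩ := hL
      obtain ⟨_, ⟨y, hyQ, rfl⟩, rfl⟩ := hM
      exact ⟨x, y, _, dir_ne φ, level_isLine φ x, level_isLine φ y⟩
    · intro x hx
      refine ⟨{y | prj φ y = prj φ x}, ?_, rfl⟩
      rw [Set.Finite.coe_toFinset]
      exact ⟨_, ⟨x, hx, rfl⟩, rfl⟩
    · intro L hL
      rw [Set.Finite.mem_toFinset] at hL
      obtain ⟨_, ⟨x, hxQ, rfl⟩, rfl⟩ := hL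
      exact ⟨x, rfl, hxQ⟩

/-- cosine at the angle `π x / (4k+2)`. -/
noncomputable def cs (k : ℕ) (x : ℝ) : ℝ := Real.cos (Real.pi * x / (4 * (k : ℝ) + 2))

lemma cs_period (k : ℕ) (x : ℝ) (m : ℤ) : cs k (x + 2 * (4 * k + 2) * m) = cs k x := by
  unfold cs
  have : Real.pi * (x + 2 * (4 * k + 2) * m) / (4 * (k : ℝ) + 2)
      = Real.pi * x / (4 * (k : ℝ) + 2) + m * (2 * Real.pi) := by
    field_simp
  rw [this, Real.cos_add_int_mul_two_pi]

lemma cs_neg (k : ℕ) (x : ℝ) : cs k (-x) = cs k x := by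
  unfold cs
  rw [← Real.cos_neg]; congr 1; ring

lemma cs_eq (k : ℕ) (x y : ℝ) (h : cs k x = cs k y) :
    ∃ m : ℤ, y = 2 * (4 * k + 2) * m + x ∨ y = 2 * (4 * k + 2) * m - x := by
  unfold cs at h
  rw [Real.cos_eq_cos_iff] at h
  have hp := Real.pi_pos
  obtain ⟨m, h | h⟩ := h
  · refine ⟨m, Or.inl ?_⟩
    field_simp at h
    linarith
  · refine ⟨m, Or.inr ?_⟩
    field_simp at h
    linarith

lemma cs_zero (k : ℕ) (x : ℝ) (h : cs k x = 0) : ∃ m : ℤ, x = (2 * m + 1) * (2 * k + 1) := by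
  unfold cs at h
  rw [Real.cos_eq_zero_iff] at h
  obtain ⟨m, h⟩ := h
  refine ⟨m, ?_⟩
  have hp := Real.pi_pos
  field_simp at h
  linarith

lemma cs_inj (k : ℕ) (a b : ℕ) (ha : a ≤ 4 * k + 2) (hb : b ≤ 4 * k + 2)
    (h : cs k a = cs k b) : a = b := by
  obtain ⟨m, h | h⟩ := cs_eq k _ _ h
  · have h : (b : ℤ) = 2 * (4 * k + 2) * m + a := by exact_mod_cast h
    have h1 : m < 1 := by by_contra!; nlinarith
    have h2 : -1 < m := by by_contra!; nlinarith
    have : m = 0 := by omega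
    subst this; omega
  · have h : (b : ℤ) = 2 * (4 * k + 2) * m - a := by exact_mod_cast h
    have h1 : m < 2 := by by_contra!; nlinarith
    have h2 : -1 < m := by by_contra!; nlinarith
    have : m = 0 ∨ m = 1 := by omega
    rcases this with rfl | rfl <;> omega

lemma cs_red (k : ℕ) (e : ℤ) : ∃ a : ℕ, a ≤ 4 * k + 2 ∧ (a : ℤ) % 2 = e % 2 ∧
    cs k (e : ℝ) = cs k a := by
  have hN : (0 : ℤ) < 2 * (4 * k + 2) := by positivity
  have h0 := Int.emod_nonneg e hN.ne'
  have h1 := Int.emod_lt_of_pos e hN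
  have h2 := Int.emod_add_mul_ediv e (2 * (4 * k + 2))
  set f := e % (2 * (4 * k + 2)) with hf
  set m := e / (2 * (4 * k + 2)) with hm
  have hpar : f % 2 = e % 2 := by
    rw [← h2, mul_assoc, Int.add_mul_emod_self_left]
  have he : cs k (e : ℝ) = cs k (f : ℝ) := by
    rw [← cs_period k f m]; congr 1; rw [← h2]; push_cast; ring
  by_cases hle : f ≤ 4 * k + 2
  · refine ⟨f.toNat, by omega, by omega, ?_⟩
    rw [he]; congr 1
    have : (f.toNat : ℤ) = f := by omega
    exact_mod_cast this.symm
  · refine ⟨(2 * (4 * k + 2) - f).toNat, by omega, by omega, ?_⟩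
    have : ((2 * (4 * k + 2) - f).toNat : ℤ) = 2 * (4 * k + 2) - f := by omega
    have h3 : ((2 * (4 * k + 2) - f).toNat : ℝ) = 2 * (4 * k + 2) - f := by exact_mod_cast this
    rw [he, h3, ← cs_neg, ← cs_period k (-f) 1]
    congr 1; push_cast; ring

/-- The set of projections. -/
noncomputable def TS (k : ℕ) (c : ℝ) : Set ℝ :=
  insert 0 (Set.range fun j : Fin (4 * k + 2) => cs k (2 * ((j : ℕ) : ℝ) - c))

lemma TS_nonint (k : ℕ) (c : ℝ) (hc : ∀ m : ℤ, c ≠ m) : (TS k c).ncard = 4 * k + 3 := by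
  unfold TS
  rw [Set.ncard_insert_of_notMem _ (Set.finite_range _), ← Set.image_univ,
    Set.ncard_image_of_injective, Set.ncard_univ, Nat.card_eq_fintype_card, Fintype.card_fin]
  · intro i j h
    simp only at h
    obtain ⟨m, h | h⟩ := cs_eq k _ _ h
    · have h : (2 * (j : ℕ) : ℝ) = 2 * (4 * k + 2) * m + 2 * (i : ℕ) := by linarith
      have h : (2 * (j : ℕ) : ℤ) = 2 * (4 * k + 2) * m + 2 * (i : ℕ) := by exact_mod_cast h
      have hi := i.2
      have hj := j.2
      have h1 : m < 1 := by by_contra!; nlinarith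
      have h2 : -1 < m := by by_contra!; nlinarith
      have : m = 0 := by omega
      subst this; ext; omega
    · exfalso
      apply hc ((i : ℕ) + (j : ℕ) - (4 * k + 2) * m)
      push_cast; linarith
  · rintro ⟨j, h⟩
    obtain ⟨m, h⟩ := cs_zero k _ h
    apply hc (2 * (j : ℕ) - (2 * m + 1) * (2 * k + 1))
    push_cast; linarith

lemma range_int (k : ℕ) (c : ℤ) :
    (Set.range fun j : Fin (4 * k + 2) => cs k (2 * ((j : ℕ) : ℝ) - c)) =
      (fun a : ℕ => cs k a) '' {a : ℕ | a ≤ 4 * k + 2 ∧ (a : ℤ) % 2 = c % 2} := by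
  ext x
  constructor
  · rintro ⟨j, rfl⟩
    obtain ⟨a, h1, h2, h3⟩ := cs_red k (2 * (j : ℕ) - c)
    refine ⟨a, ⟨h1, by omega⟩, ?_⟩
    simp only
    rw [← h3]; push_cast; rfl
  · rintro ⟨a, ⟨h1, h2⟩, rfl⟩
    obtain ⟨d, hd⟩ : ∃ d : ℤ, a + c = 2 * d := ⟨(a + c) / 2, by omega⟩
    have hN : (0 : ℤ) < 4 * k + 2 := by positivity
    have e0 := Int.emod_nonneg d hN.ne'
    have e1 := Int.emod_lt_of_pos d hN
    have e2 := Int.emod_add_mul_ediv d (4 * k + 2)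
    refine ⟨⟨(d % (4 * k + 2)).toNat, by omega⟩, ?_⟩
    simp only
    have e3 : (((d % (4 * k + 2)).toNat : ℕ) : ℤ) = d % (4 * k + 2) := by omega
    rw [← cs_period k _ (d / (4 * k + 2))]
    congr 1
    have : 2 * (((d % (4 * k + 2)).toNat : ℕ) : ℤ) - c + 2 * (4 * k + 2) * (d / (4 * k + 2)) = a := by
      rw [e3]; linarith
    exact_mod_cast this

lemma injOn_cs (k : ℕ) (c : ℤ) :
    Set.InjOn (fun a : ℕ => cs k a) {a : ℕ | a ≤ 4 * k + 2 ∧ (a : ℤ) % 2 = c % 2} :=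
  fun a ha b hb h => cs_inj k a b ha.1 hb.1 h

lemma TS_even (k : ℕ) (c : ℤ) (hc : c % 2 = 0) : (TS k c).ncard = 2 * k + 3 := by
  unfold TS
  rw [Set.ncard_insert_of_notMem _ (Set.finite_range _), range_int,
    Set.ncard_image_of_injOn (injOn_cs k c)]
  · have : {a : ℕ | a ≤ 4 * k + 2 ∧ (a : ℤ) % 2 = c % 2} =
        (fun i => 2 * i) '' ((Finset.range (2 * k + 2) : Finset ℕ) : Set ℕ) := by
      ext a
      simp only [Set.mem_setOf_eq, Set.mem_image, Finset.coe_range, Set.mem_Iio]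
      constructor
      · rintro ⟨h1, h2⟩
        exact ⟨a / 2, by omega, by omega⟩
      · rintro ⟨i, h1, rfl⟩
        omega
    rw [this, Set.ncard_image_of_injective _ (fun a b h => by simpa using h),
      Set.ncard_coe_finset, Finset.card_range]
  · rintro ⟨j, h⟩
    obtain ⟨m, h⟩ := cs_zero k _ h
    have h : (2 * (j : ℕ) : ℤ) - c = (2 * m + 1) * (2 * k + 1) := by exact_mod_cast h
    have h' : (2 * m + 1) * (2 * k + 1) = 2 * (2 * m * k + m + k) + 1 := by ring
    omega

lemma TS_odd (k : ℕ) (c : ℤ) (hc : c % 2 = 1) : (TS k c).ncard = 2 * k + 1 := by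
  unfold TS
  rw [Set.insert_eq_of_mem, range_int, Set.ncard_image_of_injOn (injOn_cs k c)]
  · have : {a : ℕ | a ≤ 4 * k + 2 ∧ (a : ℤ) % 2 = c % 2} =
        (fun i => 2 * i + 1) '' ((Finset.range (2 * k + 1) : Finset ℕ) : Set ℕ) := by
      ext a
      simp only [Set.mem_setOf_eq, Set.mem_image, Finset.coe_range, Set.mem_Iio]
      constructor
      · rintro ⟨h1, h2⟩
        exact ⟨a / 2, by omega, by omega⟩
      · rintro ⟨i, h1, rfl⟩
        omega
    rw [this, Set.ncard_image_of_injective _ (fun a b h => by simpa using h),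
      Set.ncard_coe_finset, Finset.card_range]
  · rw [range_int]
    refine ⟨2 * k + 1, ⟨by omega, by omega⟩, ?_⟩
    simp only [cs]
    rw [Real.cos_eq_zero_iff]
    refine ⟨0, ?_⟩
    push_cast
    field_simp
    ring

theorem statement_8 (k : ℕ) (hk : 1 ≤ k) (qc : ℝ × ℝ)
    (q : Fin (4 * k + 2) → ℝ × ℝ) (r θ : ℝ) (hr : 0 < r)
    (hq : ∀ j : Fin (4 * k + 2), q j = qc + r •
      (Real.cos (2 * Real.pi * ((j : ℕ) : ℝ) / (4 * (k : ℝ) + 2) + θ),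
       Real.sin (2 * Real.pi * ((j : ℕ) : ℝ) / (4 * (k : ℝ) + 2) + θ))) :
    ISet (insert qc (Set.range q)) = {2 * k + 1, 2 * k + 3, 4 * k + 3} := by
  have hfin : (insert qc (Set.range q)).Finite := (Set.finite_range q).insert qc
  have hN : (4 * (k : ℝ) + 2) ≠ 0 := by positivity
  have key : ∀ c : ℝ, (prj (θ + Real.pi * c / (4 * (k : ℝ) + 2)) ''
      (insert qc (Set.range q))).ncard = (TS k c).ncard := by
    intro c
    set φ := θ + Real.pi * c / (4 * (k : ℝ) + 2) with hφ
    have : prj φ '' (insert qc (Set.range q)) = (fun x => prj φ qc + r * x) '' TS k c := by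
      unfold TS
      rw [Set.image_insert_eq, Set.image_insert_eq, ← Set.range_comp, ← Set.range_comp]
      congr 1
      · simp
      · congr 1
        ext j
        simp only [Function.comp, hq j]
        have : cs k (2 * ((j : ℕ) : ℝ) - c) =
            Real.cos ((2 * Real.pi * ((j : ℕ) : ℝ) / (4 * (k : ℝ) + 2) + θ) - φ) := by
          unfold cs; congr 1; rw [hφ]; field_simp; ring
        rw [this, Real.cos_sub]
        simp only [prj, Prod.fst_add, Prod.snd_add, Prod.smul_fst, Prod.smul_snd, smul_eq_mul]
        ring
    rw [this, Set.ncard_image_of_injective]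
    intro x y h
    simpa [hr.ne'] using h
  ext n
  rw [mem_ISet_s8 _ hfin ⟨qc, Set.mem_insert _ _⟩]
  simp only [Set.mem_insert_iff, Set.mem_singleton_iff]
  constructor
  · rintro ⟨φ, rfl⟩
    obtain ⟨c, rfl⟩ : ∃ c : ℝ, φ = θ + Real.pi * c / (4 * (k : ℝ) + 2) := by
      refine ⟨(φ - θ) * (4 * (k : ℝ) + 2) / Real.pi, ?_⟩
      have := Real.pi_ne_zero
      field_simp
      ring
    rw [key]
    by_cases hc : ∃ m : ℤ, c = m
    · obtain ⟨m, rfl⟩ := hc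
      rcases Int.emod_two_eq_zero_or_one m with h | h
      · right; left; exact TS_even k m h
      · left; exact TS_odd k m h
    · push Not at hc
      right; right; exact TS_nonint k c hc
  · rintro (rfl | rfl | rfl)
    · exact ⟨_, (key ((1 : ℤ) : ℝ)).trans (TS_odd k 1 rfl)⟩
    · exact ⟨_, (key ((0 : ℤ) : ℝ)).trans (TS_even k 0 rfl)⟩
    · refine ⟨_, (key (1 / 2)).trans (TS_nonint k _ ?_)⟩
      intro m h
      have h : (1 : ℝ) = 2 * m := by linarith
      have h : (1 : ℤ) = 2 * m := by exact_mod_cast h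
      omega
end

section
/- For every natural number n ≥ 7 there exists a family F of n lines in ℝ² that are non-vertical, pairwise non-parallel, and not concurrent (⋂F = ∅), such that no vertical line L has L ∩ ⋃F of cardinality exactly n−1 or exactly n−2. -/
noncomputable def th (n k : ℕ) : ℝ := Real.pi * (4 * k + 1) / (2 * n)

noncomputable def sg (n s : ℕ) : ℝ := Real.pi * (2 * s + 1) / (2 * n)

lemma fline_isLine (p : ℝ × ℝ) :
    fline p = {q : ℝ × ℝ | ∃ t : ℝ, q = ((0, -p.2) : ℝ × ℝ) + t • ((1, -p.1) : ℝ × ℝ)} := by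
  ext ⟨x, y⟩
  simp only [fline, Set.mem_ofPred_eq, Prod.smul_mk, Prod.mk_add_mk, Prod.mk.injEq, smul_eq_mul]
  constructor
  · intro h
    exact ⟨x, by ring, by linarith⟩
  · rintro ⟨t, h1, h2⟩
    subst h1 h2
    ring

lemma dir_of_eq (p a v : ℝ × ℝ)
    (h : fline p = {q : ℝ × ℝ | ∃ t : ℝ, q = a + t • v}) : v.2 + p.1 * v.1 = 0 := by
  have h0 : a + (0 : ℝ) • v ∈ fline p := by rw [h]; exact ⟨0, rfl⟩
  have h1 : a + (1 : ℝ) • v ∈ fline p := by rw [h]; exact ⟨1, rfl⟩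
  simp only [fline, Set.mem_ofPred_eq, Prod.fst_add, Prod.snd_add, Prod.smul_fst, Prod.smul_snd,
    smul_eq_mul] at h0 h1
  linarith

lemma par_slope (p q : ℝ × ℝ) (h : Par (fline p) (fline q)) : p.1 = q.1 := by
  obtain ⟨a, b, v, hv, h1, h2⟩ := h
  have e1 := dir_of_eq _ _ _ h1
  have e2 := dir_of_eq _ _ _ h2
  have hv1 : v.1 ≠ 0 := by
    intro h0
    rw [h0] at e1
    apply hv
    ext
    · exact h0
    · simpa using e1
  have : (p.1 - q.1) * v.1 = 0 := by linarith
  rcases mul_eq_zero.1 this with h | h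
  · linarith
  · exact absurd h hv1

lemma par_self (p : ℝ × ℝ) : Par (fline p) (fline p) :=
  ⟨_, _, (1, -p.1), by simp, fline_isLine p, fline_isLine p⟩

lemma fline_not_vert (p : ℝ × ℝ) : ¬ IsVerticalLine (fline p) := by
  rintro ⟨a, h⟩
  have h0 : ((a, 0) : ℝ × ℝ) ∈ fline p := by rw [h]; simp
  have h1 : ((a, 1) : ℝ × ℝ) ∈ fline p := by rw [h]; simp
  simp only [fline, Set.mem_ofPred_eq] at h0 h1
  linarith

lemma sin_ne (n : ℕ) (i j : ℕ) (hi : i < n) (hj : j < n) (hij : i ≠ j) :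
    Real.sin ((th n i - th n j) / 2) ≠ 0 := by
  have hn : (n : ℝ) ≠ 0 := by
    have : n ≠ 0 := by omega
    exact_mod_cast this
  intro h
  obtain ⟨m, hm⟩ := Real.sin_eq_zero_iff.1 h
  have e : (th n i - th n j) / 2 = Real.pi * ((i - j) / n) := by
    unfold th; field_simp; ring
  rw [e, mul_comm] at hm
  have h2 := mul_left_cancel₀ Real.pi_ne_zero hm
  rw [eq_div_iff hn] at h2
  have h3 : m * n = (i : ℤ) - j := by exact_mod_cast h2
  have h4 : (n : ℤ) ∣ (i : ℤ) - j := ⟨m, by rw [← h3]; ring⟩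
  have h5 : (i : ℤ) - j = 0 := Int.eq_zero_of_abs_lt_dvd h4 (by rw [abs_lt]; omega)
  omega

lemma half_sum (n i j : ℕ) : (th n i + th n j) / 2 = sg n (i + j) := by
  unfold th sg
  push_cast
  ring

lemma sin_sg_ne (n s : ℕ) (hn : 0 < n) : Real.sin (sg n s) ≠ 0 := by
  have hn' : (n : ℝ) ≠ 0 := by positivity
  intro h
  obtain ⟨m, hm⟩ := Real.sin_eq_zero_iff.1 h
  unfold sg at hm
  rw [mul_div_assoc, mul_comm] at hm
  have h2 := mul_left_cancel₀ Real.pi_ne_zero hm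
  rw [eq_div_iff (by positivity)] at h2
  have h3 : m * (2 * n) = 2 * (s : ℤ) + 1 := by exact_mod_cast h2
  have : 2 * (m * n) = 2 * (s : ℤ) + 1 := by rw [← h3]; ring
  omega

lemma diff_eq (n : ℕ) (a : ℝ) (i j : ℕ) :
    (a * Real.cos (th n i) + Real.sin (th n i)) - (a * Real.cos (th n j) + Real.sin (th n j))
     = 2 * Real.sin ((th n i - th n j) / 2) *
        (Real.cos (sg n (i + j)) - a * Real.sin (sg n (i + j))) := by
  rw [← half_sum]
  have h1 := Real.cos_sub_cos (th n i) (th n j)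
  have h2 := Real.sin_sub_sin (th n i) (th n j)
  linear_combination a * h1 + h2

lemma cos_inj (n i j : ℕ) (hi : i < n) (hj : j < n)
    (h : Real.cos (th n i) = Real.cos (th n j)) : i = j := by
  by_contra hij
  have h1 := Real.cos_sub_cos (th n i) (th n j)
  rw [half_sum, h, sub_self] at h1
  have := sin_ne n i j hi hj hij
  have := sin_sg_ne n (i + j) (by omega)
  simp_all

lemma sg_shift (n s : ℕ) (hn : 0 < n) : sg n (s + n) = sg n s + Real.pi := by
  have hn' : (n : ℝ) ≠ 0 := by positivity
  unfold sg
  push_cast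
  field_simp
  ring

lemma shift_iff (n s : ℕ) (a : ℝ) (hn : 0 < n) :
    Real.cos (sg n (s + n)) - a * Real.sin (sg n (s + n)) = 0 ↔
    Real.cos (sg n s) - a * Real.sin (sg n s) = 0 := by
  rw [sg_shift n s hn, Real.cos_add_pi, Real.sin_add_pi]
  constructor <;> intro h <;> linarith

lemma coll (n i j : ℕ) (a : ℝ) (hi : i < n) (hj : j < n) (hij : i ≠ j)
    (h : a * Real.cos (th n i) + Real.sin (th n i) = a * Real.cos (th n j) + Real.sin (th n j)) :
    Real.cos (sg n (i + j)) - a * Real.sin (sg n (i + j)) = 0 := by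
  have h1 := diff_eq n a i j
  rw [h, sub_self] at h1
  have := sin_ne n i j hi hj hij
  have h2 := mul_eq_zero.1 h1.symm
  rcases h2 with h2 | h2
  · exact absurd h2 (by simpa using this)
  · exact h2

lemma count (n : ℕ) (hn : 7 ≤ n) (a : ℝ) (i j : ℕ) (hi : i < n) (hj : j < n) (hij : i ≠ j)
    (h : a * Real.cos (th n i) + Real.sin (th n i) = a * Real.cos (th n j) + Real.sin (th n j)) :
    ((Finset.range n).image
      (fun k => a * Real.cos (th n k) + Real.sin (th n k))).card ≤ n - 3 := by
  have hc := coll n i j a hi hj hij h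
  obtain ⟨s, hs, hsc⟩ : ∃ s < n, Real.cos (sg n s) - a * Real.sin (sg n s) = 0 := by
    by_cases hlt : i + j < n
    · exact ⟨_, hlt, hc⟩
    · refine ⟨i + j - n, by omega, ?_⟩
      rw [← shift_iff n _ a (by omega)]
      rwa [Nat.sub_add_cancel (by omega)]
  have key : ∀ k l : ℕ, k + l = s ∨ k + l = s + n →
      a * Real.cos (th n k) + Real.sin (th n k) = a * Real.cos (th n l) + Real.sin (th n l) := by
    intro k l hkl
    have h1 := diff_eq n a k l
    have h2 : Real.cos (sg n (k + l)) - a * Real.sin (sg n (k + l)) = 0 := by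
      rcases hkl with e | e
      · rw [e]; exact hsc
      · rw [e, shift_iff n s a (by omega)]; exact hsc
    rw [h2, mul_zero] at h1
    linarith
  have hsub : (Finset.range n).image (fun k => a * Real.cos (th n k) + Real.sin (th n k)) ⊆
      (Finset.Icc 0 (s / 2) ∪ Finset.Icc (s + 1) ((s + n) / 2)).image
        (fun k => a * Real.cos (th n k) + Real.sin (th n k)) := by
    intro y hy
    obtain ⟨k, hk, rfl⟩ := Finset.mem_image.1 hy
    have hk := Finset.mem_range.1 hk
    simp only [Finset.mem_image, Finset.mem_union, Finset.mem_Icc]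
    by_cases h1 : k ≤ s
    · by_cases h2 : k ≤ s / 2
      · exact ⟨k, by omega, rfl⟩
      · exact ⟨s - k, by omega, key _ _ (by omega)⟩
    · by_cases h2 : k ≤ (s + n) / 2
      · exact ⟨k, by omega, rfl⟩
      · exact ⟨s + n - k, by omega, key _ _ (by omega)⟩
  refine (Finset.card_le_card hsub).trans (Finset.card_image_le.trans
    ((Finset.card_union_le _ _).trans ?_))
  simp only [Nat.card_Icc]
  omega

theorem statement_10 (n : ℕ) (hn : 7 ≤ n) :
    ∃ F : Finset (Set (ℝ × ℝ)), F.card = n ∧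
      (∀ L ∈ F, IsLine L ∧ ¬ IsVerticalLine L) ∧
      (∀ L ∈ F, ∀ M ∈ F, L ≠ M → ¬ Par L M) ∧
      ⋂₀ (↑F : Set (Set (ℝ × ℝ))) = ∅ ∧
      ∀ a : ℝ,
        ({p : ℝ × ℝ | p.1 = a} ∩ ⋃₀ (↑F : Set (Set (ℝ × ℝ)))).ncard ≠ n - 1 ∧
        ({p : ℝ × ℝ | p.1 = a} ∩ ⋃₀ (↑F : Set (Set (ℝ × ℝ)))).ncard ≠ n - 2 := by
  classical
  let g : ℕ → Set (ℝ × ℝ) := fun k => fline (Real.cos (th n k), Real.sin (th n k))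
  have hpar : ∀ i < n, ∀ j < n, Par (g i) (g j) → i = j := by
    intro i hi j hj h
    exact cos_inj n i j hi hj (par_slope _ _ h)
  refine ⟨(Finset.range n).image g, ?_, ?_, ?_, ?_, ?_⟩
  · rw [Finset.card_image_of_injOn, Finset.card_range]
    intro i hi j hj h
    have hi : i < n := by simpa using hi
    have hj : j < n := by simpa using hj
    apply hpar i hi j hj
    have h : g i = g j := h
    rw [← h]
    exact par_self _
  · intro L hL
    obtain ⟨k, hk, rfl⟩ := Finset.mem_image.1 hL
    exact ⟨⟨_, (1, -_), by simp, fline_isLine _⟩, fline_not_vert _⟩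
  · intro L hL M hM hne hP
    obtain ⟨k, hk, rfl⟩ := Finset.mem_image.1 hL
    obtain ⟨l, hl, rfl⟩ := Finset.mem_image.1 hM
    exact hne (by rw [hpar k (Finset.mem_range.1 hk) l (Finset.mem_range.1 hl) hP])
  · rw [Set.eq_empty_iff_forall_notMem]
    rintro ⟨a, y⟩ h
    have hk : ∀ k < n, y + Real.cos (th n k) * a + Real.sin (th n k) = 0 := by
      intro k hk
      exact h (g k) (Finset.mem_coe.2 (Finset.mem_image_of_mem g (Finset.mem_range.2 hk)))
    have h0 := hk 0 (by omega)
    have h1 := hk 1 (by omega)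
    have h2 := hk 2 (by omega)
    have c1 := coll n 0 2 a (by omega) (by omega) (by omega) (by linarith)
    have c2 := coll n 0 1 a (by omega) (by omega) (by omega) (by linarith)
    have hd : (th n 1 - th n 0) / 2 = sg n (0 + 2) - sg n (0 + 1) := by
      unfold th sg; push_cast; ring
    apply sin_ne n 1 0 (by omega) (by omega) (by omega)
    rw [hd, Real.sin_sub]
    linear_combination Real.sin (sg n (0 + 2)) * c2 - Real.sin (sg n (0 + 1)) * c1
  · intro a
    have hset : ({p : ℝ × ℝ | p.1 = a} ∩ ⋃₀ (↑((Finset.range n).image g) : Set (Set (ℝ × ℝ)))) =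
        (fun y : ℝ => ((a, -y) : ℝ × ℝ)) '' (↑((Finset.range n).image
          (fun k => a * Real.cos (th n k) + Real.sin (th n k))) : Set ℝ) := by
      ext ⟨x, y⟩
      constructor
      · rintro ⟨hx, L, hL, hy⟩
        have hx : x = a := hx
        subst hx
        obtain ⟨k, hk, rfl⟩ := Finset.mem_image.1 (Finset.mem_coe.1 hL)
        have hy : y + Real.cos (th n k) * x + Real.sin (th n k) = 0 := hy
        refine ⟨_, Finset.mem_coe.2 (Finset.mem_image_of_mem _ hk), ?_⟩
        simp only [Prod.mk.injEq, true_and]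
        linarith
      · rintro ⟨z, hz, he⟩
        obtain ⟨k, hk, rfl⟩ := Finset.mem_image.1 (Finset.mem_coe.1 hz)
        simp only [Prod.mk.injEq] at he
        obtain ⟨rfl, rfl⟩ := he
        refine ⟨rfl, g k, Finset.mem_coe.2 (Finset.mem_image_of_mem g hk), ?_⟩
        simp only [g, fline, Set.mem_ofPred_eq]
        ring
    rw [hset, Set.ncard_image_of_injective _ (by
      intro u v huv
      simpa using huv), Set.ncard_coe_finset]
    by_cases hinj : Set.InjOn (fun k => a * Real.cos (th n k) + Real.sin (th n k))
        (↑(Finset.range n) : Set ℕ)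
    · rw [Finset.card_image_of_injOn hinj, Finset.card_range]
      omega
    · unfold Set.InjOn at hinj
      push Not at hinj
      obtain ⟨i, hi, j, hj, he, hne⟩ := hinj
      have := count n hn a i j (by simpa using hi) (by simpa using hj) hne he
      omega
end
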